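/- Fix real numbers 0 < R₁ < R₂ ≤ 1. For a V₄-quartic field K, let Δ₁, Δ₂, Δ₃ denote the discriminants of its three quadratic subfields, labeled so that |Δ₁| ≤ |Δ₂| ≤ |Δ₃|. Then, as X → ∞, the number of V₄-quartic subfields K of ℂ with Δ_K < X, with Δ_K odd, and with R₁²·|Δ₃| ≤ |Δ₁| and |Δ₂| < R₂²·|Δ₃| equals (1/12)·P·X^{1/2}·(log R₂ − log R₁)² + o(X^{1/2}). -/

import Mathlib

noncomputable section

/-- The (absolute) discriminant of a subfield of `ℂ`, defined to be `0` when the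
field is not finite-dimensional over `ℚ`. -/
def quartDisc (K : IntermediateField ℚ ℂ) : ℤ := by
  classical
  exact if h : FiniteDimensional ℚ K then
    haveI : CharZero K := charZero_of_injective_algebraMap (algebraMap ℚ K).injective
    haveI : NumberField K := ⟨⟩
    NumberField.discr K
  else 0

/-- A `V₄`-quartic field: a subfield of `ℂ` of degree 4 over `ℚ`, Galois over `ℚ`, with
Galois group isomorphic to the Klein four-group. -/
def IsV4Quartic (K : IntermediateField ℚ ℂ) : Prop :=
  Module.finrank ℚ K = 4 ∧ IsGalois ℚ K ∧
    Nonempty ((K ≃ₐ[ℚ] K) ≃* Multiplicative (ZMod 2 × ZMod 2))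

/-- `F` is a quadratic subfield of `K`. -/
def IsQuadSubfield (K F : IntermediateField ℚ ℂ) : Prop :=
  F ≤ K ∧ Module.finrank ℚ F = 2

section
open MeasureTheory Filter Topology Set
open scoped Pointwise ENNReal

/-- The region `Ω`; coordinates `w 0 = z`, `w 1 = y`, `w 2 = x`. -/
def Om (α β : ℝ) : Set (Fin 3 → ℝ) :=
  {w | w 1 ≤ w 2 ∧ w 0 < β * w 1 ∧ α * w 2 ≤ w 0 ∧ w 2 * w 1 * w 0 < 1}

lemma Om_pos {α β a b c : ℝ} (hα : 0 < α) (hαβ : α < β)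
    (h1 : b ≤ c) (h2 : a < β * b) (h3 : α * c ≤ a) : 0 < a ∧ 0 < b ∧ 0 < c := by
  have hβ : 0 < β := hα.trans hαβ
  have hc : 0 < c := by
    have : β * b ≤ β * c := mul_le_mul_of_nonneg_left h1 hβ.le
    nlinarith
  have ha : 0 < a := lt_of_lt_of_le (mul_pos hα hc) h3
  have hb : 0 < b := by
    by_contra h
    push Not at h
    nlinarith
  exact ⟨ha, hb, hc⟩

lemma Om_measurable (α β : ℝ) : MeasurableSet (Om α β) := by
  have e : Om α β = {w | w 1 ≤ w 2} ∩ ({w | w 0 < β * w 1} ∩ ({w | α * w 2 ≤ w 0} ∩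
      {w | w 2 * w 1 * w 0 < 1})) := rfl
  rw [e]
  refine MeasurableSet.inter (measurableSet_le (by fun_prop) (by fun_prop))
    (MeasurableSet.inter (measurableSet_lt (by fun_prop) (by fun_prop))
    (MeasurableSet.inter (measurableSet_le (by fun_prop) (by fun_prop))
      (measurableSet_lt (by fun_prop) (by fun_prop))))

lemma Om_bound {α β a b c t : ℝ} (hα : 0 < α) (hαβ : α < β) (hβ : β ≤ 1)
    (h1 : b ≤ c) (h2 : a < β * b) (h3 : α * c ≤ a) (ht : 0 < t) (h4 : c * b * a < t ^ 3) :
    c < t / α := by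
  obtain ⟨ha, hb, hc⟩ := Om_pos hα hαβ h1 h2 h3
  have hab : a < b := by nlinarith
  rw [lt_div_iff₀ hα]
  have h5 : (c * α) ^ 3 < t ^ 3 := by
    have hα1 : α < 1 := by linarith
    have e1 : c * α ≤ a := by linarith
    have e2 : c * α ≤ b := by linarith
    have e3 : c * α ≤ c := by nlinarith
    have e0 : 0 < c * α := by positivity
    calc (c * α) ^ 3 = (c * α) * (c * α) * (c * α) := by ring
      _ ≤ c * b * a := by gcongr
      _ < t ^ 3 := h4
  exact lt_of_pow_lt_pow_left₀ 3 ht.le h5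

lemma Om_bounded {α β : ℝ} (hα : 0 < α) (hαβ : α < β) (hβ : β ≤ 1) :
    Bornology.IsBounded (Om α β) := by
  refine (Metric.isBounded_Icc (0 : Fin 3 → ℝ) (fun _ => 1 / α)).subset ?_
  rintro w ⟨h1, h2, h3, h4⟩
  obtain ⟨ha, hb, hc⟩ := Om_pos hα hαβ h1 h2 h3
  have h5 := Om_bound hα hαβ hβ h1 h2 h3 one_pos (by simpa using h4)
  have hab : w 0 < w 1 := by nlinarith
  constructor
  · intro i; fin_cases i <;> simp <;> linarith
  · intro i; fin_cases i <;> simp <;> simp at h5 <;> linarith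

lemma Om_star {α β : ℝ} (hα : 0 < α) (hαβ : α < β) ⦃x y : ℝ⦄ (hx : 0 < x) (hxy : x ≤ y) :
    x • Om α β ⊆ y • Om α β := by
  rintro _ ⟨w, ⟨h1, h2, h3, h4⟩, rfl⟩
  obtain ⟨ha, hb, hc⟩ := Om_pos hα hαβ h1 h2 h3
  have hy : 0 < y := hx.trans_le hxy
  refine ⟨(x / y) • w, ?_, ?_⟩
  · have hq : 0 < x / y := by positivity
    have hq1 : x / y ≤ 1 := by rw [div_le_one hy]; exact hxy
    simp only [Om, mem_ofPred_eq, Pi.smul_apply, smul_eq_mul]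
    set q := x / y
    refine ⟨by gcongr, by nlinarith, by nlinarith, ?_⟩
    calc q * w 2 * (q * w 1) * (q * w 0) = q ^ 3 * (w 2 * w 1 * w 0) := by ring
      _ ≤ 1 * (w 2 * w 1 * w 0) := by
        gcongr; exact pow_le_one₀ hq.le hq1
      _ < 1 := by linarith
  · simp only [smul_smul]
    congr 1
    field_simp

/-- coordinates -/
def e3 : (Fin 3 → ℝ) ≃ᵐ ℝ × (ℝ × ℝ) :=
  (MeasurableEquiv.piFinSuccAbove (fun _ : Fin 3 => ℝ) 0).trans
    (MeasurableEquiv.prodCongr (MeasurableEquiv.refl ℝ) MeasurableEquiv.finTwoArrow)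

lemma e3_apply (w : Fin 3 → ℝ) : e3 w = (w 0, w 1, w 2) := by
  simp [e3, MeasurableEquiv.piFinSuccAbove, MeasurableEquiv.finTwoArrow, MeasurableEquiv.prodCongr,MeasurableEquiv.piFinTwo, Fin.insertNthEquiv]
  exact ⟨rfl, rfl⟩

lemma e3_mp : MeasurePreserving e3 volume volume := by
  refine MeasurePreserving.trans (volume_preserving_piFinSuccAbove (fun _ : Fin 3 => ℝ) 0) ?_
  exact (MeasurePreserving.id volume).prod (volume_preserving_finTwoArrow ℝ)

lemma vol_e3 (s : Set (ℝ × ℝ × ℝ)) : volume {w : Fin 3 → ℝ | (w 0, w 1, w 2) ∈ s} = volume s := by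
  rw [← e3_mp.measure_preimage_equiv]
  congr 1

lemma null_xyz : volume {w : Fin 3 → ℝ | w 2 * w 1 * w 0 = 1} = 0 := by
  have := vol_e3 {p | p.2.2 * p.2.1 * p.1 = 1}
  simp only [mem_ofPred_eq] at this
  rw [this]
  rw [Measure.volume_eq_prod, Measure.measure_prod_null (by measurability)]
  refine Eventually.of_forall fun a => ?_
  change (volume.prod volume) (Prod.mk a ⁻¹' {p : ℝ × ℝ × ℝ | p.2.2 * p.2.1 * p.1 = 1}) = 0
  rw [Measure.measure_prod_null]
  · refine Eventually.of_forall fun b => ?_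
    refine Set.Subsingleton.measure_zero ?_ _
    intro c hc c' hc'
    simp only [mem_preimage, mem_ofPred_eq] at hc hc'
    have hb : b * a ≠ 0 := by
      rintro h
      rw [mul_assoc, h] at hc
      simp at hc
    apply mul_right_cancel₀ hb
    rw [← mul_assoc, ← mul_assoc, hc, hc']
  · exact measurable_prodMk_left (measurableSet_eq_fun (by fun_prop) (by fun_prop))

lemma null_lin (f : (Fin 3 → ℝ) →ₗ[ℝ] ℝ) (w : Fin 3 → ℝ) (hw : f w ≠ 0) :
    volume {v : Fin 3 → ℝ | f v = 0} = 0 := by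
  have := Measure.addHaar_submodule (volume : Measure (Fin 3 → ℝ)) (LinearMap.ker f) (by
    intro h
    apply hw
    have : w ∈ LinearMap.ker f := h ▸ Submodule.mem_top
    exact this)
  convert this using 2
  ext v
  simp

lemma Om_frontier {α β : ℝ} (hα : 0 < α) (hβ : 0 < β) : volume (frontier (Om α β)) = 0 := by
  have hsub : frontier (Om α β) ⊆
      {w | w 2 * w 1 * w 0 = 1} ∪ {w | w 1 = w 2} ∪ {w | w 0 = β * w 1} ∪ {w | α * w 2 = w 0} := by
    have e : Om α β = {w | w 1 ≤ w 2} ∩ ({w | w 0 < β * w 1} ∩ ({w | α * w 2 ≤ w 0} ∩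
      {w | w 2 * w 1 * w 0 < 1})) := rfl
    intro w hw
    rw [e] at hw
    rcases frontier_inter_subset _ _ hw with h | h
    · have := frontier_le_subset_eq (by fun_prop) (by fun_prop) h.1
      simp only [mem_union]; tauto
    rcases frontier_inter_subset _ _ h.2 with h | h
    · have := frontier_lt_subset_eq (by fun_prop) (by fun_prop) h.1
      simp only [mem_union]; tauto
    rcases frontier_inter_subset _ _ h.2 with h | h
    · have := frontier_le_subset_eq (by fun_prop) (by fun_prop) h.1
      simp only [mem_union]; tauto
    have := frontier_lt_subset_eq (by fun_prop) (by fun_prop) h.2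
    simp only [mem_union]; tauto
  refine measure_mono_null hsub ?_
  refine measure_union_null (measure_union_null (measure_union_null null_xyz ?_) ?_) ?_
  · refine measure_mono_null (fun v hv => ?_)
      (null_lin ((1 : ℝ) • LinearMap.proj 1 - LinearMap.proj (R := ℝ) 2) ![0, 1, 0] (by
        simp [LinearMap.sub_apply]))
    simp only [mem_ofPred_eq, LinearMap.sub_apply, LinearMap.proj_apply, LinearMap.smul_apply,
      smul_eq_mul] at hv ⊢
    linarith
  · refine measure_mono_null (fun v hv => ?_)
      (null_lin (LinearMap.proj 0 - β • LinearMap.proj (R := ℝ) 1) ![0, 1, 0] (by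
        simp [LinearMap.sub_apply, hβ.ne']))
    simp only [mem_ofPred_eq, LinearMap.sub_apply, LinearMap.proj_apply, LinearMap.smul_apply,
      smul_eq_mul] at hv ⊢
    linarith
  · refine measure_mono_null (fun v hv => ?_)
      (null_lin (α • LinearMap.proj 2 - LinearMap.proj (R := ℝ) 0) ![1, 0, 0] (by
        simp [LinearMap.sub_apply]))
    simp only [mem_ofPred_eq, LinearMap.sub_apply, LinearMap.proj_apply, LinearMap.smul_apply,
      smul_eq_mul] at hv ⊢
    linarith

lemma int_r {q : ℝ} (hq : 0 < q) :
    ∫⁻ r in Ioi (0 : ℝ), ENNReal.ofReal (r ^ 2) * (if r ^ 3 * q < 1 then 1 else 0)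
      = ENNReal.ofReal (1 / 3 * q⁻¹) := by
  set c : ℝ := (q⁻¹) ^ ((1 : ℝ) / 3) with hc
  have hc0 : 0 < c := by positivity
  have hc3 : c ^ 3 = q⁻¹ := by
    rw [hc, ← Real.rpow_natCast, ← Real.rpow_mul (by positivity)]
    norm_num
  have hiff : ∀ r : ℝ, 0 < r → (r ^ 3 * q < 1 ↔ r < c) := by
    intro r hr
    rw [← lt_div_iff₀ hq, one_div, ← hc3]
    exact pow_lt_pow_iff_left₀ hr.le hc0.le (by norm_num)
  have h1 : ∫⁻ r in Ioi (0 : ℝ), ENNReal.ofReal (r ^ 2) * (if r ^ 3 * q < 1 then 1 else 0)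
      = ∫⁻ r in Ioi (0 : ℝ), (Iio c).indicator (fun r => ENNReal.ofReal (r ^ 2)) r := by
    refine setLIntegral_congr_fun measurableSet_Ioi fun r hr => ?_
    rw [mem_Ioi] at hr
    simp only [hiff r hr]
    by_cases h : r < c
    · simp [h]
    · simp [h]
  rw [h1, setLIntegral_indicator measurableSet_Iio, Iio_inter_Ioi,
    ← ofReal_integral_eq_lintegral_ofReal]
  · congr 1
    rw [← integral_Ioc_eq_integral_Ioo, ← intervalIntegral.integral_of_le hc0.le, integral_pow, ← hc3]
    norm_num; ring
  · exact ((continuous_pow 2).integrableOn_Icc (a := 0) (b := c)).mono_set Ioo_subset_Icc_self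
  · exact Eventually.of_forall fun r => by positivity

lemma int_uv {a b : ℝ} (ha : 0 < a) (hab : a ≤ b) :
    ∫⁻ u in Ioc a b, ∫⁻ v in Icc u b, ENNReal.ofReal (1 / 3 * (u * v)⁻¹)
      = ENNReal.ofReal (1 / 6 * (Real.log b - Real.log a) ^ 2) := by
  have hin : ∀ u ∈ Ioc a b, ∫⁻ v in Icc u b, ENNReal.ofReal (1 / 3 * (u * v)⁻¹)
      = ENNReal.ofReal (1 / 3 * u⁻¹ * (Real.log b - Real.log u)) := by
    intro u hu
    have hu0 : 0 < u := ha.trans hu.1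
    rw [← ofReal_integral_eq_lintegral_ofReal]
    · congr 1
      rw [integral_Icc_eq_integral_Ioc, ← intervalIntegral.integral_of_le hu.2]
      simp_rw [mul_inv, ← mul_assoc]
      rw [intervalIntegral.integral_const_mul, integral_inv_of_pos hu0 (hu0.trans_le hu.2),
        Real.log_div (hu0.trans_le hu.2).ne' hu0.ne']
    · apply ContinuousOn.integrableOn_Icc
      intro v hv
      have : u * v ≠ 0 := (mul_pos hu0 (hu0.trans_le hv.1)).ne'
      apply ContinuousAt.continuousWithinAt
      fun_prop (disch := assumption)
    · rw [EventuallyLE, ae_restrict_iff' measurableSet_Icc]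
      refine Eventually.of_forall fun v hv => ?_
      have : 0 < v := hu0.trans_le hv.1
      simp only [Pi.zero_apply]; positivity
  rw [setLIntegral_congr_fun measurableSet_Ioc hin]
  have hcont : ContinuousOn (fun u => 1 / 3 * u⁻¹ * (Real.log b - Real.log u)) (Icc a b) := by
    intro u hu
    have : u ≠ 0 := (ha.trans_le hu.1).ne'
    apply ContinuousAt.continuousWithinAt
    fun_prop (disch := assumption)
  rw [← ofReal_integral_eq_lintegral_ofReal]
  · congr 1
    rw [← intervalIntegral.integral_of_le hab]
    have : ∀ u ∈ uIcc a b, HasDerivAt (fun u => - (1 / 6) * (Real.log b - Real.log u) ^ 2)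
        (1 / 3 * u⁻¹ * (Real.log b - Real.log u)) u := by
      intro u hu
      rw [uIcc_of_le hab] at hu
      have hu0 : u ≠ 0 := (ha.trans_le hu.1).ne'
      have := (((Real.hasDerivAt_log hu0).const_sub (Real.log b)).pow 2).const_mul (-(1/6 : ℝ))
      convert! this using 1
      simp; ring
    rw [intervalIntegral.integral_eq_sub_of_hasDerivAt this]
    · simp
    · apply ContinuousOn.intervalIntegrable
      rwa [uIcc_of_le hab]
  · exact hcont.integrableOn_Icc.mono_set Ioc_subset_Icc_self
  · rw [EventuallyLE, ae_restrict_iff' measurableSet_Ioc]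
    refine Eventually.of_forall fun u hu => ?_
    have h0 : 0 < u := ha.trans hu.1
    have := Real.log_le_log h0 hu.2
    simp only [Pi.zero_apply]
    have : 0 ≤ Real.log b - Real.log u := by linarith
    positivity

/-- the section of the cone -/
def Dset (α β : ℝ) : Set (ℝ × ℝ) := {p | p.1 ≤ p.2 ∧ 1 < β * p.1 ∧ α * p.2 ≤ 1}

lemma Dset_meas (α β : ℝ) : MeasurableSet (Dset α β) := by
  have e : Dset α β = {p | p.1 ≤ p.2} ∩ ({p | 1 < β * p.1} ∩ {p | α * p.2 ≤ 1}) := rfl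
  rw [e]
  exact MeasurableSet.inter (measurableSet_le (by fun_prop) (by fun_prop))
    (MeasurableSet.inter (measurableSet_lt (by fun_prop) (by fun_prop))
    (measurableSet_le (by fun_prop) (by fun_prop)))

lemma Om_slice {α β r : ℝ} (hr : 0 < r) :
    volume {p : ℝ × ℝ | p.1 ≤ p.2 ∧ r < β * p.1 ∧ α * p.2 ≤ r ∧ p.2 * p.1 * r < 1}
      = ENNReal.ofReal (r ^ 2) *
        ∫⁻ p in Dset α β, (if r ^ 3 * (p.1 * p.2) < 1 then 1 else 0) := by
  have h1 : {p : ℝ × ℝ | p.1 ≤ p.2 ∧ r < β * p.1 ∧ α * p.2 ≤ r ∧ p.2 * p.1 * r < 1}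
      = r • ({p : ℝ × ℝ | r ^ 3 * (p.1 * p.2) < 1} ∩ Dset α β) := by
    ext p
    rw [mem_smul_set_iff_inv_smul_mem₀ hr.ne']
    simp only [mem_ofPred_eq, mem_inter_iff, Dset, Prod.smul_fst, Prod.smul_snd, smul_eq_mul]
    have e1 : r ^ 3 * (r⁻¹ * p.1 * (r⁻¹ * p.2)) = p.2 * p.1 * r := by field_simp
    have e2 : r⁻¹ * p.1 ≤ r⁻¹ * p.2 ↔ p.1 ≤ p.2 := by
      exact mul_le_mul_iff_right₀ (inv_pos.2 hr)
    have e3 : 1 < β * (r⁻¹ * p.1) ↔ r < β * p.1 := by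
      rw [show β * (r⁻¹ * p.1) = β * p.1 / r by ring, one_lt_div hr]
    have e4 : α * (r⁻¹ * p.2) ≤ 1 ↔ α * p.2 ≤ r := by
      rw [show α * (r⁻¹ * p.2) = α * p.2 / r by ring, div_le_one hr]
    rw [e1, e2, e3, e4]
    tauto
  have hm : MeasurableSet {p : ℝ × ℝ | r ^ 3 * (p.1 * p.2) < 1} :=
    measurableSet_lt (by fun_prop) (by fun_prop)
  rw [h1, Measure.addHaar_smul]
  congr 1
  · simp
  · have : ∀ p : ℝ × ℝ, (if r ^ 3 * (p.1 * p.2) < 1 then (1 : ℝ≥0∞) else 0) =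
        {p : ℝ × ℝ | r ^ 3 * (p.1 * p.2) < 1}.indicator (fun _ => 1) p := by
      intro p; simp [indicator_apply]
    simp_rw [this]
    rw [setLIntegral_indicator hm]
    simp

lemma Om_volume {α β : ℝ} (hα : 0 < α) (hαβ : α < β) :
    volume.real (Om α β) = 1 / 6 * (Real.log β - Real.log α) ^ 2 := by
  have hβ : 0 < β := hα.trans hαβ
  have h1 : volume (Om α β) = volume {p : ℝ × ℝ × ℝ |
      p.2.1 ≤ p.2.2 ∧ p.1 < β * p.2.1 ∧ α * p.2.2 ≤ p.1 ∧ p.2.2 * p.2.1 * p.1 < 1} :=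
    vol_e3 {p : ℝ × ℝ × ℝ |
      p.2.1 ≤ p.2.2 ∧ p.1 < β * p.2.1 ∧ α * p.2.2 ≤ p.1 ∧ p.2.2 * p.2.1 * p.1 < 1}
  have hms : MeasurableSet {p : ℝ × ℝ × ℝ |
      p.2.1 ≤ p.2.2 ∧ p.1 < β * p.2.1 ∧ α * p.2.2 ≤ p.1 ∧ p.2.2 * p.2.1 * p.1 < 1} := by
    exact MeasurableSet.inter (s₁ := {p : ℝ × ℝ × ℝ | p.2.1 ≤ p.2.2})
      (measurableSet_le (by fun_prop) (by fun_prop))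
      (MeasurableSet.inter (s₁ := {p : ℝ × ℝ × ℝ | p.1 < β * p.2.1})
        (measurableSet_lt (by fun_prop) (by fun_prop))
      (MeasurableSet.inter (s₁ := {p : ℝ × ℝ × ℝ | α * p.2.2 ≤ p.1})
        (s₂ := {p : ℝ × ℝ × ℝ | p.2.2 * p.2.1 * p.1 < 1})
        (measurableSet_le (by fun_prop) (by fun_prop))
      (measurableSet_lt (by fun_prop) (by fun_prop))))
  have h2 : volume (Om α β) = ∫⁻ r in Ioi (0 : ℝ), ∫⁻ p in Dset α β,
      ENNReal.ofReal (r ^ 2) * (if r ^ 3 * (p.1 * p.2) < 1 then 1 else 0) := by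
    rw [h1, Measure.volume_eq_prod, Measure.prod_apply hms,
      ← setLIntegral_eq_of_support_subset (s := Ioi (0 : ℝ))]
    · refine setLIntegral_congr_fun measurableSet_Ioi fun r hr => ?_
      rw [lintegral_const_mul]
      · exact Om_slice hr
      · refine Measurable.ite (measurableSet_lt (by fun_prop) (by fun_prop)) ?_ ?_ <;> fun_prop
    · intro r hr
      rw [Function.mem_support] at hr
      obtain ⟨p, hp⟩ := nonempty_of_measure_ne_zero hr
      exact (Om_pos hα hαβ hp.1 hp.2.1 hp.2.2.1).1
  have h3 : volume (Om α β) = ∫⁻ p in Dset α β, ENNReal.ofReal (1 / 3 * (p.1 * p.2)⁻¹) := by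
    rw [h2, lintegral_lintegral_swap]
    · refine setLIntegral_congr_fun (Dset_meas α β) fun p hp => ?_
      apply int_r
      have := Om_pos hα hαβ hp.1 hp.2.1 hp.2.2
      exact mul_pos this.2.1 this.2.2
    · apply Measurable.aemeasurable
      refine Measurable.mul (by fun_prop) ?_
      refine Measurable.ite (measurableSet_lt (by fun_prop) (by fun_prop)) ?_ ?_ <;> fun_prop
  have h4 : volume (Om α β) = ENNReal.ofReal (1 / 6 * (Real.log (1 / α) - Real.log (1 / β)) ^ 2) := by
    rw [h3, ← int_uv (by positivity) (one_div_le_one_div_of_le hα hαβ.le), ← lintegral_indicator (Dset_meas α β),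
      Measure.volume_eq_prod, lintegral_prod, ← lintegral_indicator measurableSet_Ioc]
    · congr 1
      ext u
      by_cases hu : u ∈ Ioc (1 / β) (1 / α)
      · rw [indicator_of_mem hu, ← lintegral_indicator measurableSet_Icc]
        congr 1
        ext v
        have : (u, v) ∈ Dset α β ↔ v ∈ Icc u (1 / α) := by
          have hu' := hu.1
          rw [div_lt_iff₀' hβ] at hu'
          rw [mem_Icc, le_div_iff₀' hα]
          simp only [Dset, mem_ofPred_eq]
          tauto
        by_cases hv : v ∈ Icc u (1 / α)
        · rw [indicator_of_mem hv, indicator_of_mem (this.2 hv)]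
        · rw [indicator_of_notMem hv, indicator_of_notMem (fun h => hv (this.1 h))]
      · rw [indicator_of_notMem hu]
        rw [lintegral_eq_zero_of_ae_eq_zero]
        refine Eventually.of_forall fun v => ?_
        apply indicator_of_notMem
        rintro ⟨h5, h6, h7⟩
        apply hu
        simp only at h5 h6 h7
        rw [mem_Ioc, div_lt_iff₀' hβ, le_div_iff₀' hα]
        exact ⟨h6, by nlinarith⟩
    · apply Measurable.aemeasurable
      exact Measurable.indicator (by fun_prop) (Dset_meas α β)
  rw [Measure.real, h4, ENNReal.toReal_ofReal (by positivity)]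
  simp only [one_div, Real.log_inv]
  ring
end

section
open MeasureTheory Filter Topology Set
open scoped Pointwise ENNReal

open Classical in
/-- integer points of the dilated region -/
noncomputable def Sf (α β t : ℝ) : Finset (Fin 3 → ℕ) :=
  (Fintype.piFinset fun _ => Finset.range ⌈t / α⌉₊).filter fun v =>
    (v 1 : ℝ) ≤ v 2 ∧ (v 0 : ℝ) < β * v 1 ∧ α * v 2 ≤ v 0 ∧ (v 2 * v 1 * v 0 : ℝ) < t ^ 3

lemma mem_Sf {α β t : ℝ} (hα : 0 < α) (hαβ : α < β) (hβ : β ≤ 1) (ht : 0 < t) (v : Fin 3 → ℕ) :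
    v ∈ Sf α β t ↔
    (v 1 : ℝ) ≤ v 2 ∧ (v 0 : ℝ) < β * v 1 ∧ α * v 2 ≤ v 0 ∧ (v 2 * v 1 * v 0 : ℝ) < t ^ 3 := by
  unfold Sf
  rw [Finset.mem_filter, and_iff_right_iff_imp]
  rintro ⟨h1, h2, h3, h4⟩
  obtain ⟨ha, hb, hc⟩ := Om_pos hα hαβ h1 h2 h3
  have h5 := Om_bound hα hαβ hβ h1 h2 h3 ht h4
  have hab : (v 0 : ℝ) < v 1 := by nlinarith
  rw [Fintype.mem_piFinset]
  intro i
  rw [Finset.mem_range, Nat.lt_ceil]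
  fin_cases i <;> simp <;> linarith

lemma mem_L (x : Fin 3 → ℝ) : x ∈ (Submodule.span ℤ (Set.range (Pi.basisFun ℝ (Fin 3)))) ↔
    ∀ i, ∃ n : ℤ, (n : ℝ) = x i := by
  rw [Module.Basis.mem_span_iff_repr_mem]
  simp

lemma count_div {α β : ℝ} (hα : 0 < α) (hαβ : α < β) (hβ : β ≤ 1) (d : Fin 3 → ℕ)
    (hd : ∀ i, 0 < d i) :
    Tendsto (fun t : ℝ => (((Sf α β t).filter (fun v => ∀ i, d i ∣ v i)).card : ℝ) / t ^ 3) atTop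
      (𝓝 (volume.real (Om α β) * ∏ i, (d i : ℝ)⁻¹)) := by
  have hd' : ∀ i, (0 : ℝ) < d i := fun i => by exact_mod_cast hd i
  let D : (Fin 3 → ℝ) ≃ₜ (Fin 3 → ℝ) := Homeomorph.piCongrRight fun i =>
    Homeomorph.mulLeft₀ (d i : ℝ) (hd' i).ne'
  have hD : ∀ w i, D w i = d i * w i := fun w i => rfl
  have hDs : ∀ (c : ℝ) w, D (c • w) = c • D w := by
    intro c w; ext i; simp only [hD, Pi.smul_apply, smul_eq_mul]; ring
  have hpre : ∀ s : Set (Fin 3 → ℝ), volume (D ⁻¹' s) = ENNReal.ofReal (∏ i, (d i : ℝ)⁻¹) * volume s := by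
    intro s
    have := Measure.addHaar_preimage_linearMap (volume : Measure (Fin 3 → ℝ))
      (f := Matrix.toLin' (Matrix.diagonal fun i => (d i : ℝ))) (by
        rw [LinearMap.det_toLin', Matrix.det_diagonal]
        exact Finset.prod_ne_zero_iff.2 fun i _ => (hd' i).ne') s
    have e : (D ⁻¹' s) = (Matrix.toLin' (Matrix.diagonal fun i => (d i : ℝ))) ⁻¹' s := by
      ext w
      simp only [mem_preimage]
      have : D w = (Matrix.toLin' (Matrix.diagonal fun i => (d i : ℝ))) w := by
        ext i
        simp [hD, Matrix.toLin'_apply, Matrix.mulVec_diagonal]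
      rw [this]
    rw [e, this, LinearMap.det_toLin', Matrix.det_diagonal, ← Finset.prod_inv_distrib, abs_of_nonneg]
    exact Finset.prod_nonneg fun i _ => by positivity
  have key := tendsto_card_div_pow_atTop_volume' (D ⁻¹' (Om α β)) ?_ ?_ ?_ ?_
  · have hv : volume.real (D ⁻¹' (Om α β)) = volume.real (Om α β) * ∏ i, (d i : ℝ)⁻¹ := by
      rw [Measure.real, hpre, ENNReal.toReal_mul, ENNReal.toReal_ofReal, mul_comm]
      · rfl
      · exact Finset.prod_nonneg fun i _ => by positivity
    rw [hv] at key
    refine key.congr' ?_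
    filter_upwards [eventually_gt_atTop 0] with t ht
    rw [Fintype.card_fin]
    congr 2
    let φ : (Fin 3 → ℕ) → (Fin 3 → ℝ) := fun v i => t⁻¹ * (v i / d i)
    have hφ : Function.Injective φ := by
      intro v w h
      ext i
      have := congrFun h i
      simp only [φ] at this
      have := mul_left_cancel₀ (inv_ne_zero ht.ne') this
      rw [div_left_inj' (hd' i).ne'] at this
      exact_mod_cast this
    have him : (D ⁻¹' (Om α β) ∩ t⁻¹ • ((Submodule.span ℤ (Set.range (Pi.basisFun ℝ (Fin 3)))) : Set (Fin 3 → ℝ)))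
        = φ '' ↑((Sf α β t).filter (fun v => ∀ i, d i ∣ v i)) := by
      ext w
      rw [mem_inter_iff, mem_smul_set_iff_inv_smul_mem₀ (inv_ne_zero ht.ne'), inv_inv,
        SetLike.mem_coe, mem_L, mem_preimage]
      have hDw : ∀ w, D w ∈ Om α β ↔ (t * D w 1 ≤ t * D w 2 ∧ t * D w 0 < β * (t * D w 1) ∧
          α * (t * D w 2) ≤ t * D w 0 ∧ (t * D w 2) * (t * D w 1) * (t * D w 0) < t ^ 3) := by
        intro w
        simp only [Om, mem_ofPred_eq]
        have e1 : β * (t * D w 1) = t * (β * D w 1) := by ring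
        have e2 : α * (t * D w 2) = t * (α * D w 2) := by ring
        have e3 : (t * D w 2) * (t * D w 1) * (t * D w 0) = t ^ 3 * (D w 2 * D w 1 * D w 0) := by ring
        rw [e1, e2, e3, mul_le_mul_iff_right₀ ht, mul_lt_mul_iff_right₀ ht, mul_le_mul_iff_right₀ ht,
          mul_lt_iff_lt_one_right (by positivity)]
      rw [hDw]
      constructor
      · rintro ⟨⟨h1, h2, h3, h4⟩, h5⟩
        choose n hn using h5
        simp only [Pi.smul_apply, smul_eq_mul] at hn
        obtain ⟨ha, hb, hc⟩ := Om_pos hα hαβ h1 h2 h3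
        have hpos : ∀ i, 0 < n i := by
          intro i
          have : 0 < t * D w i := by fin_cases i <;> assumption
          rw [hD] at this
          have h6 : 0 < (d i : ℝ) * (n i : ℝ) := by rw [hn]; linarith
          have := pos_of_mul_pos_right h6 (hd' i).le
          exact_mod_cast this
        have hnn : ∀ i, (((n i).toNat : ℕ) : ℝ) = t * w i := by
          intro i
          rw [← hn]
          have := Int.toNat_of_nonneg (hpos i).le
          exact_mod_cast this
        have hv : ∀ i, ((d i * (n i).toNat : ℕ) : ℝ) = t * D w i := by
          intro i
          push_cast
          rw [hnn, hD]; ring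
        refine ⟨fun i => d i * (n i).toNat, ?_, ?_⟩
        · rw [SetLike.mem_coe, Finset.mem_filter, mem_Sf hα hαβ hβ ht]
          simp only [hv]
          exact ⟨⟨h1, h2, h3, h4⟩, fun i => Dvd.intro _ rfl⟩
        · ext i
          simp only [φ]
          rw [hv, hD]
          have := (hd' i).ne'
          field_simp
      · rintro ⟨v, hv, rfl⟩
        rw [SetLike.mem_coe, Finset.mem_filter, mem_Sf hα hαβ hβ ht] at hv
        have hh : ∀ i, t * D (φ v) i = v i := by
          intro i
          rw [hD]
          simp only [φ]
          have := (hd' i).ne'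
          field_simp
        simp only [hh]
        refine ⟨hv.1, fun i => ?_⟩
        obtain ⟨k, hk⟩ := hv.2 i
        refine ⟨k, ?_⟩
        simp only [φ, Pi.smul_apply, smul_eq_mul]
        rw [hk]
        have := (hd' i).ne'
        push_cast
        field_simp
    rw [him, Nat.card_coe_set_eq, Set.ncard_image_of_injective _ hφ, Set.ncard_coe_finset]
  · have hb := Om_bounded hα hαβ hβ
    obtain ⟨C, hC⟩ := hb.exists_norm_le
    refine (Metric.isBounded_closedBall (x := (0 : Fin 3 → ℝ)) (r := C)).subset fun w hw => ?_
    rw [mem_closedBall_zero_iff]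
    have h1 := hC _ hw
    refine le_trans ?_ h1
    rw [pi_norm_le_iff_of_nonneg (norm_nonneg _)]
    intro i
    refine le_trans ?_ (norm_le_pi_norm (D w) i)
    rw [hD, norm_mul]
    have : (1 : ℝ) ≤ ‖(d i : ℝ)‖ := by
      rw [Real.norm_natCast]; exact_mod_cast hd i
    exact le_mul_of_one_le_left (norm_nonneg _) this
  · exact D.continuous.measurable (Om_measurable α β)
  · rw [← D.preimage_frontier, hpre, Om_frontier hα (hα.trans hαβ), mul_zero]
  · rintro x y hx hxy _ ⟨w, hw, rfl⟩
    have hy : 0 < y := hx.trans_le hxy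
    have := Om_star hα hαβ hx hxy (smul_mem_smul_set hw)
    rw [mem_smul_set_iff_inv_smul_mem₀ hy.ne'] at this ⊢
    rw [mem_preimage, hDs]
    simpa [hDs] using this
end

section
open MeasureTheory Filter Topology Set
open scoped Pointwise ENNReal

/-- forbidden exponent patterns at a prime -/
def Eset (p : ℕ) : Finset (Fin 3 → ℕ) :=
  if p = 2 then {![1, 0, 0], ![0, 1, 0], ![0, 0, 1]}
  else {![2, 0, 0], ![0, 2, 0], ![0, 0, 2], ![1, 1, 0], ![1, 0, 1], ![0, 1, 1]}

/-- local condition at a prime -/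
def Loc (p : ℕ) (v : Fin 3 → ℕ) : Prop := ∀ e ∈ Eset p, ¬ ∀ i, p ^ (e i) ∣ v i

open Classical in
/-- indicator of the local condition -/
noncomputable def floc (p : ℕ) (v : Fin 3 → ℕ) : ℝ := if Loc p v then 1 else 0

/-- local density -/
noncomputable def mloc (p : ℕ) : ℝ :=
  if p = 2 then 1 / 8 else 1 - 6 / (p : ℝ) ^ 2 + 8 / (p : ℝ) ^ 3 - 3 / (p : ℝ) ^ 4

open Classical in
/-- indicator of divisibility -/
noncomputable def ind (d : Fin 3 → ℕ) (v : Fin 3 → ℕ) : ℝ := if ∀ i, d i ∣ v i then 1 else 0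

open Classical in
lemma ind_eq_prod (d v : Fin 3 → ℕ) : ind d v = ∏ i, (if d i ∣ v i then (1 : ℝ) else 0) := by
  unfold ind
  rw [Finset.prod_ite_zero]
  simp

lemma ind_mul (d d' v : Fin 3 → ℕ) (h : ∀ i, Nat.Coprime (d i) (d' i)) :
    ind d v * ind d' v = ind (fun i => d i * d' i) v := by
  have : (∀ i, d i * d' i ∣ v i) ↔ (∀ i, d i ∣ v i) ∧ ∀ i, d' i ∣ v i := by
    rw [← forall_and]
    refine forall_congr' fun i => ?_
    exact ⟨fun h' => ⟨dvd_of_mul_right_dvd h', dvd_of_mul_left_dvd h'⟩,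
      fun h' => (h i).mul_dvd_of_dvd_of_dvd h'.1 h'.2⟩
  unfold ind
  simp only [this]
  by_cases h1 : ∀ i, d i ∣ v i <;> by_cases h2 : ∀ i, d' i ∣ v i <;> simp [h1, h2]

open Classical in
lemma expand_aux {ι : Type*} (s : Finset ι) (co : ι → Fin 3 → Fin 3 → ℝ) (g : Fin 3 → Fin 3 → ℝ) :
    ∑ e : Fin 3 → Fin 3, (∑ h ∈ s, ∏ i, co h i (e i)) * ∏ i, g i (e i) =
      ∑ h ∈ s, ∏ i, ∑ k, co h i k * g i k := by
  simp_rw [Finset.prod_univ_sum, Fintype.piFinset_univ, Finset.prod_mul_distrib, Finset.sum_mul]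
  rw [Finset.sum_comm]

lemma expand (p : ℕ) (hp : p.Prime) : ∃ c : (Fin 3 → Fin 3) → ℝ,
    (∀ v, floc p v = ∑ e, c e * ind (fun i => p ^ (e i : ℕ)) v) ∧
    ∑ e, c e * ∏ i, ((p ^ (e i : ℕ) : ℕ) : ℝ)⁻¹ = mloc p := by
  classical
  have hp0 : (p : ℝ) ≠ 0 := by exact_mod_cast hp.ne_zero
  have hdv : ∀ n, p ^ 2 ∣ n → p ∣ n := fun n h => (dvd_pow_self p two_ne_zero).trans h
  by_cases h2 : p = 2
  · subst h2
    refine ⟨fun e => ∑ h ∈ ({()} : Finset Unit), ∏ i, (fun _ _ => ![1, -1, 0]) h i (e i), ?_, ?_⟩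
    · intro v
      simp_rw [ind_eq_prod]
      rw [expand_aux {()} (fun _ _ => ![1, -1, 0])
        (fun i k => if 2 ^ (k : ℕ) ∣ v i then (1 : ℝ) else 0)]
      simp only [floc, Loc, Eset, Fin.sum_univ_three, Fin.prod_univ_three]
      simp only [Finset.mem_insert, Finset.mem_singleton, forall_eq_or_imp, forall_eq,
        Fin.forall_fin_succ]
      by_cases h0 : 2 ∣ v 0 <;> by_cases h1 : 2 ∣ v 1 <;> by_cases h2 : 2 ∣ v 2 <;>
        simp [h0, h1, h2]
    · rw [expand_aux {()} (fun _ _ => ![1, -1, 0])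
        (fun i k => (((2 ^ (k : ℕ) : ℕ) : ℝ)⁻¹))]
      simp [Fin.sum_univ_three, Fin.prod_univ_three, mloc]
      norm_num
  · let co : Option (Fin 3) → Fin 3 → Fin 3 → ℝ :=
      fun h i => if h = some i then ![0, 1, -1] else ![1, -1, 0]
    refine ⟨fun e => ∑ h, ∏ i, co h i (e i), ?_, ?_⟩
    · intro v
      simp_rw [ind_eq_prod]
      rw [expand_aux Finset.univ co (fun i k => if p ^ (k : ℕ) ∣ v i then (1 : ℝ) else 0)]
      simp only [floc, Loc, Eset, if_neg h2, Fin.sum_univ_three, Fin.prod_univ_three,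
        Fintype.sum_option, co]
      simp only [Finset.mem_insert, Finset.mem_singleton, forall_eq_or_imp, forall_eq,
        Fin.forall_fin_succ]
      have k0 := hdv (v 0)
      have k1 := hdv (v 1)
      have k2 := hdv (v 2)
      by_cases h0 : p ∣ v 0 <;> by_cases h1 : p ∣ v 1 <;> by_cases h2 : p ∣ v 2 <;>
      by_cases h0' : p ^ 2 ∣ v 0 <;> by_cases h1' : p ^ 2 ∣ v 1 <;> by_cases h2' : p ^ 2 ∣ v 2 <;>
        simp_all
    · rw [expand_aux Finset.univ co (fun i k => (((p ^ (k : ℕ) : ℕ) : ℝ)⁻¹))]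
      simp [Fin.sum_univ_three, Fin.prod_univ_three, mloc, Fintype.sum_option, co, h2]
      field_simp
      ring

lemma sieve_fin {α β : ℝ} (hα : 0 < α) (hαβ : α < β) (hβ : β ≤ 1) (S : Finset ℕ)
    (hS : ∀ p ∈ S, p.Prime) : ∀ (d : Fin 3 → ℕ), (∀ i, 0 < d i) →
    (∀ p ∈ S, ∀ i, Nat.Coprime p (d i)) →
    Tendsto (fun t : ℝ => (∑ v ∈ Sf α β t, ind d v * ∏ p ∈ S, floc p v) / t ^ 3) atTop
      (𝓝 (volume.real (Om α β) * ((∏ i, (d i : ℝ)⁻¹) * ∏ p ∈ S, mloc p))) := by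
  classical
  induction S using Finset.induction_on with
  | empty =>
    intro d hd _
    have := count_div hα hαβ hβ d hd
    simp only [Finset.prod_empty, mul_one]
    refine this.congr fun t => ?_
    congr 1
    rw [Finset.card_filter]
    push_cast
    refine Finset.sum_congr rfl fun v _ => ?_
    unfold ind
    congr
  | insert p S hpS ih =>
    intro d hd hcop
    have hp : p.Prime := hS p (Finset.mem_insert_self _ _)
    obtain ⟨c, hc1, hc2⟩ := expand p hp
    have ih' := fun e : Fin 3 → Fin 3 => ih (fun q hq => hS q (Finset.mem_insert_of_mem hq))
      (fun i => d i * p ^ (e i : ℕ)) (fun i => Nat.mul_pos (hd i) (pow_pos hp.pos _))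
      (fun q hq i => Nat.Coprime.mul_right (hcop q (Finset.mem_insert_of_mem hq) i)
        (Nat.Coprime.pow_right _ ((Nat.coprime_primes (hS q (Finset.mem_insert_of_mem hq)) hp).2
          (fun h => hpS (h ▸ hq)))))
    have hsum := tendsto_finsetSum (Finset.univ) (fun e (_ : e ∈ Finset.univ) =>
      (ih' e).const_mul (c e))
    convert hsum using 1
    · ext t
      simp_rw [mul_div_assoc']
      rw [← Finset.sum_div]
      congr 1
      simp_rw [Finset.mul_sum]
      rw [Finset.sum_comm]
      refine Finset.sum_congr rfl fun v _ => ?_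
      rw [Finset.prod_insert hpS, hc1 v, Finset.sum_mul, Finset.mul_sum]
      refine Finset.sum_congr rfl fun e _ => ?_
      rw [← ind_mul]
      · ring
      · intro i
        exact (Nat.Coprime.pow_left _ (hcop p (Finset.mem_insert_self _ _) i)).symm
    · congr 1
      rw [Finset.prod_insert hpS, ← hc2, Finset.sum_mul, Finset.mul_sum, Finset.mul_sum]
      refine Finset.sum_congr rfl fun e _ => ?_
      have : ∏ i, (((d i * p ^ (e i : ℕ) : ℕ)) : ℝ)⁻¹ =
          (∏ i, (d i : ℝ)⁻¹) * ∏ i, ((p ^ (e i : ℕ) : ℕ) : ℝ)⁻¹ := by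
        rw [← Finset.prod_mul_distrib]
        refine Finset.prod_congr rfl fun i _ => ?_
        push_cast
        rw [mul_inv]
      rw [this]
      ring
end

section
open MeasureTheory Filter Topology Set
open scoped Pointwise ENNReal

/-- all local conditions -/
def Good (v : Fin 3 → ℕ) : Prop := ∀ p : ℕ, p.Prime → Loc p v

/-- primes up to `N` -/
def prN (N : ℕ) : Finset ℕ := (Finset.range (N + 1)).filter Nat.Prime

lemma mem_prN {N p : ℕ} : p ∈ prN N ↔ p ≤ N ∧ p.Prime := by
  simp [prN, Nat.lt_succ_iff]

lemma E_sum {p : ℕ} (hp : p ≠ 2) {e : Fin 3 → ℕ} (he : e ∈ Eset p) : e 0 + e 1 + e 2 = 2 := by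
  simp only [Eset, if_neg hp, Finset.mem_insert, Finset.mem_singleton] at he
  rcases he with h | h | h | h | h | h <;> simp [h]

lemma E_card (p : ℕ) : (Eset p).card ≤ 6 := by
  unfold Eset
  split_ifs
  · exact (Finset.card_le_three).trans (by norm_num)
  · exact Finset.card_le_six

open Classical in
lemma tail_bound (M N : ℕ) (hN : 2 ≤ N) (A : Finset (Fin 3 → ℕ))
    (hA : ∀ v ∈ A, ∀ i, 0 < v i ∧ v i ≤ M) :
    ((A.filter fun v => (∀ p ∈ prN N, Loc p v) ∧ ¬ Good v).card : ℝ) ≤ 6 * (M : ℝ) ^ 3 / N := by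
  have hNpos : (0 : ℝ) < N := by exact_mod_cast (by omega : 0 < N)
  rcases le_or_gt M N with hMN | hMN
  · rw [Finset.card_eq_zero.2]
    · simp; positivity
    rw [Finset.filter_eq_empty_iff]
    rintro v hv ⟨h1, h2⟩
    apply h2
    intro p hp
    rcases le_or_gt p N with hpN | hpN
    · exact h1 p (mem_prN.2 ⟨hpN, hp⟩)
    intro e he hdiv
    have hs := E_sum (by omega) he
    have : ∃ i, e i ≠ 0 := by
      by_contra! h
      simp [h] at hs
    obtain ⟨i, hi⟩ := this
    have h3 : p ∣ v i := (dvd_pow_self p hi).trans (hdiv i)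
    have := Nat.le_of_dvd (hA v hv i).1 h3
    have := (hA v hv i).2
    omega
  let B : ℕ → (Fin 3 → ℕ) → Finset (Fin 3 → ℕ) := fun p e =>
    Fintype.piFinset fun i => (Finset.Ioc 0 M).filter (fun n => p ^ (e i) ∣ n)
  have hsub : (A.filter fun v => (∀ p ∈ prN N, Loc p v) ∧ ¬ Good v) ⊆
      (Finset.Ioc N M).biUnion fun p => (Eset p).biUnion fun e => B p e := by
    intro v hv
    rw [Finset.mem_filter] at hv
    obtain ⟨hvA, h1, h2⟩ := hv
    unfold Good at h2
    push Not at h2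
    obtain ⟨p, hp, hL⟩ := h2
    have hpN : N < p := by
      by_contra h
      exact hL (h1 p (mem_prN.2 ⟨by omega, hp⟩))
    unfold Loc at hL
    push Not at hL
    obtain ⟨e, he, hdiv⟩ := hL
    have hs := E_sum (by omega) he
    have : ∃ i, e i ≠ 0 := by
      by_contra! h
      simp [h] at hs
    obtain ⟨i, hi⟩ := this
    have h3 : p ∣ v i := (dvd_pow_self p hi).trans (hdiv i)
    have h4 := Nat.le_of_dvd (hA v hvA i).1 h3
    have h5 := (hA v hvA i).2
    simp only [Finset.mem_biUnion, Finset.mem_Ioc]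
    refine ⟨p, ⟨hpN, by omega⟩, e, he, ?_⟩
    simp only [B, Fintype.mem_piFinset, Finset.mem_filter, Finset.mem_Ioc]
    exact fun i => ⟨hA v hvA i, hdiv i⟩
  have hB : ∀ p ∈ Finset.Ioc N M, ∀ e ∈ Eset p, ((B p e).card : ℝ) ≤ (M : ℝ) ^ 3 * ((p : ℝ) ^ 2)⁻¹ := by
    intro p hp e he
    rw [Finset.mem_Ioc] at hp
    have hs := E_sum (by omega) he
    simp only [B, Fintype.card_piFinset, Nat.Ioc_filter_dvd_card_eq_div, Fin.prod_univ_three]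
    push_cast
    have hle : ∀ i, ((M / p ^ e i : ℕ) : ℝ) ≤ M / (p : ℝ) ^ e i := by
      intro i
      refine Nat.cast_div_le.trans ?_
      push_cast; rfl
    have hp0 : (0 : ℝ) < p := by exact_mod_cast (by omega : 0 < p)
    calc ((M / p ^ e 0 : ℕ) : ℝ) * ((M / p ^ e 1 : ℕ) : ℝ) * ((M / p ^ e 2 : ℕ) : ℝ)
        ≤ (M / (p : ℝ) ^ e 0) * (M / (p : ℝ) ^ e 1) * (M / (p : ℝ) ^ e 2) := by
          gcongr <;> apply hle
      _ = (M : ℝ) ^ 3 * ((p : ℝ) ^ (e 0 + e 1 + e 2))⁻¹ := by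
          rw [pow_add, pow_add]; field_simp
      _ = _ := by rw [hs]
  calc ((A.filter fun v => (∀ p ∈ prN N, Loc p v) ∧ ¬ Good v).card : ℝ)
      ≤ (((Finset.Ioc N M).biUnion fun p => (Eset p).biUnion fun e => B p e).card : ℝ) := by
        exact_mod_cast Finset.card_le_card hsub
    _ ≤ ∑ p ∈ Finset.Ioc N M, ∑ e ∈ Eset p, ((B p e).card : ℝ) := by
        have h1 := Finset.card_biUnion_le (s := Finset.Ioc N M)
          (t := fun p => (Eset p).biUnion fun e => B p e)
        have h2 : ∑ p ∈ Finset.Ioc N M, ((Eset p).biUnion fun e => B p e).card ≤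
            ∑ p ∈ Finset.Ioc N M, ∑ e ∈ Eset p, (B p e).card :=
          Finset.sum_le_sum fun p _ => Finset.card_biUnion_le
        exact_mod_cast h1.trans h2
    _ ≤ ∑ p ∈ Finset.Ioc N M, 6 * ((M : ℝ) ^ 3 * ((p : ℝ) ^ 2)⁻¹) := by
        refine Finset.sum_le_sum fun p hp => ?_
        refine (Finset.sum_le_sum (hB p hp)).trans ?_
        rw [Finset.sum_const, nsmul_eq_mul]
        gcongr
        exact_mod_cast E_card p
    _ = 6 * (M : ℝ) ^ 3 * ∑ p ∈ Finset.Ioc N M, ((p : ℝ) ^ 2)⁻¹ := by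
        rw [Finset.mul_sum]
        refine Finset.sum_congr rfl fun p _ => by ring
    _ ≤ 6 * (M : ℝ) ^ 3 * (N : ℝ)⁻¹ := by
        gcongr
        have := sum_Ioc_inv_sq_le_sub (α := ℝ) (by omega : N ≠ 0) hMN.le
        refine this.trans ?_
        simp
    _ = _ := by ring

lemma prod_lim : Tendsto (fun N => ∏ p ∈ prN N, mloc p) atTop (𝓝 (1 / 8 *
    ∏' p : {p : ℕ // p.Prime ∧ Odd p},
      (1 - 6 / (p.1 : ℝ) ^ 2 + 8 / (p.1 : ℝ) ^ 3 - 3 / (p.1 : ℝ) ^ 4))) := by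
  classical
  set F : {p : ℕ // p.Prime ∧ Odd p} → ℝ := fun p =>
    (1 - 6 / (p.1 : ℝ) ^ 2 + 8 / (p.1 : ℝ) ^ 3 - 3 / (p.1 : ℝ) ^ 4) with hF
  have hsum : Summable fun p : {p : ℕ // p.Prime ∧ Odd p} => ‖F p - 1‖ := by
    have h1 : Summable fun n : ℕ => 17 * ((n : ℝ) ^ 2)⁻¹ :=
      (Real.summable_nat_pow_inv.2 (by norm_num)).mul_left 17
    have h2 := h1.comp_injective (Subtype.val_injective (p := fun p : ℕ => p.Prime ∧ Odd p))
    refine Summable.of_nonneg_of_le (fun _ => norm_nonneg _) (fun p => ?_) h2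
    simp only [Function.comp]
    have hp : (1 : ℝ) ≤ p.1 := by exact_mod_cast p.2.1.one_lt.le
    have h3 : 1 / (p.1 : ℝ) ^ 3 ≤ 1 / (p.1 : ℝ) ^ 2 := by
      apply one_div_le_one_div_of_le (by positivity); exact pow_le_pow_right₀ hp (by norm_num)
    have h4 : 1 / (p.1 : ℝ) ^ 4 ≤ 1 / (p.1 : ℝ) ^ 2 := by
      apply one_div_le_one_div_of_le (by positivity); exact pow_le_pow_right₀ hp (by norm_num)
    have h5 : 0 < 1 / (p.1 : ℝ) ^ 3 := by positivity
    have h6 : 0 < 1 / (p.1 : ℝ) ^ 4 := by positivity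
    have h7 : 0 < 1 / (p.1 : ℝ) ^ 2 := by positivity
    rw [Real.norm_eq_abs, abs_le, ← one_div]
    simp only [hF]
    rw [div_eq_mul_one_div 6, div_eq_mul_one_div 8, div_eq_mul_one_div 3]
    constructor <;> linarith
  have hmul : Multipliable F := by
    have := multipliable_one_add_of_summable hsum
    simpa using this
  have hprod := hmul.hasProd
  have hS : Tendsto (fun N : ℕ => (Finset.range (N + 1)).subtype (fun p => p.Prime ∧ Odd p)) atTop atTop := by
    apply tendsto_atTop_finset_of_monotone
    · intro a b hab x hx
      simp only [Finset.mem_subtype, Finset.mem_range] at hx ⊢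
      omega
    · intro x
      exact ⟨x.1, by simp⟩
  have h1 := (hprod.comp hS).const_mul (1 / 8 : ℝ)
  refine h1.congr' ?_
  filter_upwards [eventually_ge_atTop 2] with N hN
  have h2 : prN N = insert 2 ((Finset.range (N + 1)).filter (fun p => p.Prime ∧ Odd p)) := by
    ext p
    simp only [mem_prN, Finset.mem_insert, Finset.mem_filter, Finset.mem_range]
    constructor
    · rintro ⟨h1, h2⟩
      rcases h2.eq_two_or_odd' with h | h
      · exact Or.inl h
      · exact Or.inr ⟨by omega, h2, h⟩
    · rintro (h | ⟨h1, h2, h3⟩)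
      · subst h; exact ⟨hN, Nat.prime_two⟩
      · exact ⟨by omega, h2⟩
  rw [h2, Finset.prod_insert (by simp)]
  have hm2 : mloc 2 = 1 / 8 := by simp [mloc]
  rw [hm2]
  congr 1
  · rw [Function.comp_apply, ← Finset.prod_subtype_eq_prod_filter]
    refine Finset.prod_congr rfl fun p _ => ?_
    have : p.1 ≠ 2 := by
      intro h
      have := p.2.2
      rw [h] at this
      exact absurd this (by decide)
    simp [mloc, this, hF]

open Classical in
lemma count_good {α β : ℝ} (hα : 0 < α) (hαβ : α < β) (hβ : β ≤ 1) :
    Tendsto (fun t : ℝ => (((Sf α β t).filter Good).card : ℝ) / t ^ 3) atTop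
      (𝓝 (volume.real (Om α β) * (1 / 8 * ∏' p : {p : ℕ // p.Prime ∧ Odd p},
      (1 - 6 / (p.1 : ℝ) ^ 2 + 8 / (p.1 : ℝ) ^ 3 - 3 / (p.1 : ℝ) ^ 4)))) := by
  set P := (1 / 8 * ∏' p : {p : ℕ // p.Prime ∧ Odd p},
      (1 - 6 / (p.1 : ℝ) ^ 2 + 8 / (p.1 : ℝ) ^ 3 - 3 / (p.1 : ℝ) ^ 4)) with hP
  set V := volume.real (Om α β)
  have hU : ∀ N, Tendsto (fun t : ℝ => (((Sf α β t).filter fun v => ∀ p ∈ prN N, Loc p v).card : ℝ) / t ^ 3)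
      atTop (𝓝 (V * ∏ p ∈ prN N, mloc p)) := by
    intro N
    have := sieve_fin hα hαβ hβ (prN N) (fun p hp => (mem_prN.1 hp).2) (fun _ => 1) (by simp) (by simp)
    simp only [Nat.cast_one, inv_one, Finset.prod_const_one, one_mul] at this
    refine this.congr fun t => ?_
    congr 1
    rw [Finset.card_filter]
    push_cast
    refine Finset.sum_congr rfl fun v _ => ?_
    simp [ind, floc, Finset.prod_ite_zero]
  have hlim := prod_lim.const_mul V
  rw [← hP] at hlim
  have hC : Tendsto (fun N : ℕ => 48 / α ^ 3 / (N : ℝ)) atTop (𝓝 0) :=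
    tendsto_const_div_atTop_nhds_zero_nat _
  rw [Metric.tendsto_nhds]
  intro ε hε
  have e1 := (Metric.tendsto_nhds.1 hlim) (ε / 3) (by positivity)
  have e2 := (Metric.tendsto_nhds.1 hC) (ε / 3) (by positivity)
  obtain ⟨N, h1, h2, hN⟩ := (e1.and (e2.and (eventually_ge_atTop 2))).exists
  have e3 := (Metric.tendsto_nhds.1 (hU N)) (ε / 3) (by positivity)
  filter_upwards [e3, eventually_ge_atTop 1] with t h3 ht
  have ht0 : 0 < t := by linarith
  have hsplit : ((Sf α β t).filter fun v => ∀ p ∈ prN N, Loc p v).card =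
      ((Sf α β t).filter Good).card +
      ((Sf α β t).filter fun v => (∀ p ∈ prN N, Loc p v) ∧ ¬ Good v).card := by
    rw [← Finset.card_filter_add_card_filter_not (s := (Sf α β t).filter fun v => ∀ p ∈ prN N, Loc p v) Good]
    rw [Finset.filter_filter, Finset.filter_filter]
    congr 2
    ext v
    simp only [Finset.mem_filter]
    have : Good v → ∀ p ∈ prN N, Loc p v := fun h p hp => h p (mem_prN.1 hp).2
    tauto
  have htail := tail_bound ⌈t / α⌉₊ N hN (Sf α β t) (by
    intro v hv i
    have hv' := (mem_Sf hα hαβ hβ ht0 v).1 hv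
    obtain ⟨ha, hb, hc⟩ := Om_pos hα hαβ hv'.1 hv'.2.1 hv'.2.2.1
    constructor
    · have : (0 : ℝ) < v i := by fin_cases i <;> assumption
      exact_mod_cast this
    · unfold Sf at hv
      rw [Finset.mem_filter, Fintype.mem_piFinset] at hv
      exact (Finset.mem_range.1 (hv.1 i)).le)
  have hα1 : α < 1 := by linarith
  have hM : (⌈t / α⌉₊ : ℝ) ≤ 2 * (t / α) := by
    have h5 := Nat.ceil_lt_add_one (a := t / α) (by positivity)
    have h6 : 1 ≤ t / α := by rw [le_div_iff₀ hα]; linarith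
    linarith
  have hNpos : (0 : ℝ) < N := by exact_mod_cast (by omega : 0 < N)
  have htail2 : (((Sf α β t).filter fun v => (∀ p ∈ prN N, Loc p v) ∧ ¬ Good v).card : ℝ) / t ^ 3
      ≤ 48 / α ^ 3 / N := by
    rw [div_le_iff₀ (by positivity)]
    refine htail.trans ?_
    calc 6 * (⌈t / α⌉₊ : ℝ) ^ 3 / N ≤ 6 * (2 * (t / α)) ^ 3 / N := by gcongr
      _ = 48 / α ^ 3 / N * t ^ 3 := by field_simp; ring
  have htail0 : 0 ≤ (((Sf α β t).filter fun v => (∀ p ∈ prN N, Loc p v) ∧ ¬ Good v).card : ℝ) / t ^ 3 := by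
    positivity
  rw [hsplit] at h3
  push_cast at h3
  rw [add_div] at h3
  rw [Real.dist_eq, abs_lt] at h1 h2 h3 ⊢
  constructor <;> linarith [h1.1, h1.2, h2.1, h2.2, h3.1, h3.2]
end

section
open NumberField

theorem tr_zero {K : Type*} [Field K] [Algebra ℚ K] [FiniteDimensional ℚ K] (x : K) (q : ℚ)
    (hx : x ^ 2 = algebraMap ℚ K q) (hn : ∀ r : ℚ, algebraMap ℚ K r ≠ x) :
    Algebra.trace ℚ K x = 0 := by
  have hInteg : IsIntegral ℚ x := Algebra.IsIntegral.isIntegral x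
  have hm : minpoly ℚ x = Polynomial.X ^ 2 - Polynomial.C q := by
    symm
    apply minpoly.eq_of_irreducible_of_monic
    · rw [X_pow_sub_C_irreducible_iff_of_prime Nat.prime_two]
      intro b hb
      have : (x - algebraMap ℚ K b) * (x + algebraMap ℚ K b) = 0 := by
        have : (algebraMap ℚ K b)^2 = algebraMap ℚ K q := by rw [← map_pow, hb]
        linear_combination hx - this
      rcases mul_eq_zero.1 this with h | h
      · exact hn b (sub_eq_zero.1 h).symm
      · exact hn (-b) (by rw [map_neg]; exact (eq_neg_of_add_eq_zero_left h).symm)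
    · simp [hx]
    · exact Polynomial.monic_X_pow_sub_C q two_ne_zero
  rw [trace_eq_finrank_mul_minpoly_nextCoeff, hm]
  have : (Polynomial.X ^ 2 - Polynomial.C q).nextCoeff = 0 := by
    rw [Polynomial.nextCoeff_of_natDegree_pos] <;> simp [Polynomial.coeff_X, Polynomial.coeff_C]
  rw [this]; simp

/-- index formula -/
theorem idx {K : Type*} [Field K] [NumberField K] {n : ℕ} (hn : Module.finrank ℚ K = n)
    (b : Fin n → K) (hb : ∀ i, IsIntegral ℤ (b i)) :
    ∃ m : ℤ, Algebra.discr ℚ b = (m : ℚ) ^ 2 * (discr K : ℚ) := by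
  classical
  have hc : Fintype.card (Module.Free.ChooseBasisIndex ℤ (𝓞 K)) = n := by
    rw [← hn, ← RingOfIntegers.rank K, Module.finrank_eq_card_chooseBasisIndex]
  let e := Fintype.equivFinOfCardEq hc
  let B := (RingOfIntegers.basis K).reindex e
  let B' := (integralBasis K).reindex e
  have hB' : ∀ i, B' i = algebraMap (𝓞 K) K (B i) := by
    intro i; simp [B, B', integralBasis_apply]
  let M : Matrix (Fin n) (Fin n) ℤ := Matrix.of fun i j => B.repr ⟨b i, hb i⟩ j
  have hbM : b = Matrix.mulVec ((M.map (algebraMap ℤ ℚ)).map (algebraMap ℚ K)) B' := by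
    funext i
    have h1 := B.sum_repr (⟨b i, hb i⟩ : 𝓞 K)
    have h2 := congrArg (algebraMap (𝓞 K) K) h1
    rw [map_sum] at h2
    have h3 : algebraMap (𝓞 K) K ⟨b i, hb i⟩ = b i := rfl
    rw [h3] at h2
    rw [← h2]
    simp only [Matrix.mulVec, dotProduct, M, Matrix.map_apply, Matrix.of_apply, hB']
    apply Finset.sum_congr rfl
    intro j _
    simp
  refine ⟨M.det, ?_⟩
  rw [coe_discr]
  have h4 : Algebra.discr ℚ (integralBasis K) = Algebra.discr ℚ B' := by
    rw [← Algebra.discr_reindex ℚ (integralBasis K) e]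
    congr 1
    funext i; simp [B']
  rw [h4, hbM, Algebra.discr_of_matrix_mulVec]
  congr 2
  rw [← RingHom.mapMatrix_apply, ← RingHom.map_det]; simp

theorem discr_orth {K : Type*} [Field K] [Algebra ℚ K] {n : ℕ} (b : Fin n → K)
    (h : ∀ i j, i ≠ j → Algebra.trace ℚ K (b i * b j) = 0) :
    Algebra.discr ℚ b = ∏ i, Algebra.trace ℚ K (b i * b i) := by
  rw [Algebra.discr_def]
  have : Algebra.traceMatrix ℚ b = Matrix.diagonal fun i => Algebra.trace ℚ K (b i * b i) := by
    ext i j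
    rw [Algebra.traceMatrix_apply, Algebra.traceForm_apply, Matrix.diagonal_apply]
    split_ifs with hij
    · rw [hij]
    · exact h i j hij
  rw [this, Matrix.det_diagonal]

/-- x is not rational -/
def Irr {K : Type*} [Field K] [Algebra ℚ K] (x : K) : Prop := ∀ r : ℚ, algebraMap ℚ K r ≠ x

theorem Irr.smul_mul {K : Type*} [Field K] [Algebra ℚ K] {x : K} (h : Irr x) {q : ℚ} (hq : q ≠ 0) :
    Irr (algebraMap ℚ K q * x) := by
  intro r hr
  apply h (r / q)
  have : algebraMap ℚ K q ≠ 0 := (map_ne_zero _).2 hq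
  rw [map_div₀, hr]; field_simp

theorem Irr.ne_zero {K : Type*} [Field K] [Algebra ℚ K] {x : K} (h : Irr x) : x ≠ 0 := by
  rintro rfl
  exact h 0 (by simp)

theorem five {K : Type*} [Field K] [Algebra ℚ K] [FiniteDimensional ℚ K]
    (hn : Module.finrank ℚ K = 4) (s1 s2 s : K) (a b d : ℚ) (h1 : s1 ^ 2 = algebraMap ℚ K a)
    (h2 : s2 ^ 2 = algebraMap ℚ K b) (h : s ^ 2 = algebraMap ℚ K d)
    (i1 : Irr s1) (i2 : Irr s2) (i12 : Irr (s1 * s2)) (i : Irr s)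
    (j1 : Irr (s1 * s)) (j2 : Irr (s2 * s)) (j12 : Irr (s1 * s2 * s)) : False := by
  have ha : a ≠ 0 := by
    rintro rfl; simp at h1; exact i1.ne_zero h1
  have hb : b ≠ 0 := by
    rintro rfl; simp at h2; exact i2.ne_zero h2
  have hd : d ≠ 0 := by
    rintro rfl; simp at h; exact i.ne_zero h
  have t1 := tr_zero s1 _ h1 i1
  have t2 := tr_zero s2 _ h2 i2
  have t := tr_zero s _ h i
  have t12 := tr_zero (s1*s2) (a*b) (by rw [map_mul, ← h1, ← h2]; ring) i12
  have u1 := tr_zero (s1*s) (a*d) (by rw [map_mul, ← h1, ← h]; ring) j1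
  have u2 := tr_zero (s2*s) (b*d) (by rw [map_mul, ← h2, ← h]; ring) j2
  have u12 := tr_zero (s1*s2*s) (a*b*d) (by rw [map_mul, map_mul, ← h1, ← h2, ← h]; ring) j12
  have v1 : Algebra.trace ℚ K (s1*(s1*s2)) = 0 := by
    rw [show s1*(s1*s2) = algebraMap ℚ K a * s2 by rw [← h1]; ring, ← Algebra.smul_def, map_smul, t2]
    simp
  have v2 : Algebra.trace ℚ K (s2*(s1*s2)) = 0 := by
    rw [show s2*(s1*s2) = algebraMap ℚ K b * s1 by rw [← h2]; ring, ← Algebra.smul_def, map_smul, t1]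
    simp
  have hD := discr_orth ![1, s1, s2, s1 * s2, s] (by
    intro i j hij
    fin_cases i <;> fin_cases j <;> first | exact absurd rfl hij | skip
    all_goals
      simp only [Fin.mk_zero, Fin.zero_eta, Fin.isValue, Matrix.cons_val, Fin.mk_one, Fin.reduceFinMk,
        one_mul, mul_one]
      first | assumption | (rw [mul_comm]; assumption))
  have hne : Algebra.discr ℚ ![1, s1, s2, s1 * s2, s] ≠ 0 := by
    rw [hD]
    rw [Finset.prod_ne_zero_iff]
    intro i _
    have key : ∃ q : ℚ, q ≠ 0 ∧ (![1, s1, s2, s1 * s2, s] i * ![1, s1, s2, s1 * s2, s] i) = algebraMap ℚ K q := by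
      fin_cases i
      · exact ⟨1, one_ne_zero, by simp⟩
      · exact ⟨a, ha, by rw [← h1]; simp; ring⟩
      · exact ⟨b, hb, by rw [← h2]; simp; ring⟩
      · exact ⟨a*b, mul_ne_zero ha hb, by rw [map_mul, ← h1, ← h2]; simp; ring⟩
      · exact ⟨d, hd, by rw [← h]; simp; ring⟩
    obtain ⟨q, hq, e⟩ := key
    rw [e, Algebra.trace_algebraMap, hn]
    simpa using hq
  have hli : LinearIndependent ℚ ![1, s1, s2, s1 * s2, s] := by
    by_contra hc
    exact hne (Algebra.discr_zero_of_not_linearIndependent ℚ hc)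
  have := hli.fintype_card_le_finrank
  rw [hn] at this
  simp at this

theorem four {K : Type*} [Field K] [Algebra ℚ K] [FiniteDimensional ℚ K]
    (s1 s2 s : K) (a b d : ℚ) (h1 : s1 ^ 2 = algebraMap ℚ K a)
    (h2 : s2 ^ 2 = algebraMap ℚ K b) (h : s ^ 2 = algebraMap ℚ K d)
    (i1 : Irr s1) (i2 : Irr s2) (i : Irr s) (i12 : Irr (s1 * s2)) (j1 : Irr (s1 * s))
    (j2 : Irr (s2 * s)) : Algebra.discr ℚ ![1, s1, s2, s] =
      (Module.finrank ℚ K : ℚ) ^ 4 * (a * b * d) := by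
  have t1 := tr_zero s1 _ h1 i1
  have t2 := tr_zero s2 _ h2 i2
  have t := tr_zero s _ h i
  have t12 := tr_zero (s1*s2) (a*b) (by rw [map_mul, ← h1, ← h2]; ring) i12
  have u1 := tr_zero (s1*s) (a*d) (by rw [map_mul, ← h1, ← h]; ring) j1
  have u2 := tr_zero (s2*s) (b*d) (by rw [map_mul, ← h2, ← h]; ring) j2
  have hD := discr_orth ![1, s1, s2, s] (by
    intro i j hij
    fin_cases i <;> fin_cases j <;> first | exact absurd rfl hij | skip
    all_goals
      simp only [Fin.mk_zero, Fin.zero_eta, Fin.isValue, Matrix.cons_val, Fin.mk_one, Fin.reduceFinMk,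
        one_mul, mul_one]
      first | assumption | (rw [mul_comm]; assumption))
  rw [hD, Fin.prod_univ_four]
  simp only [Matrix.cons_val, ← sq, h1, h2, h]
  rw [show (1:K)^2 = algebraMap ℚ K 1 by simp]
  simp only [Algebra.trace_algebraMap, nsmul_eq_mul]
  ring

theorem two {K : Type*} [Field K] [Algebra ℚ K] [FiniteDimensional ℚ K]
    (s : K) (d : ℚ) (h : s ^ 2 = algebraMap ℚ K d) (i : Irr s) : Algebra.discr ℚ ![1, s] =
      (Module.finrank ℚ K : ℚ) ^ 2 * d := by
  have t := tr_zero s _ h i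
  have hD := discr_orth ![1, s] (by
    intro i j hij
    fin_cases i <;> fin_cases j <;> first | exact absurd rfl hij | skip
    all_goals simpa using t)
  rw [hD, Fin.prod_univ_two]
  simp only [Matrix.cons_val, ← sq, h]
  rw [show (1:K)^2 = algebraMap ℚ K 1 by simp]
  simp only [Algebra.trace_algebraMap, nsmul_eq_mul]
  ring
end

section
open NumberField

theorem half_int {K : Type*} [Field K] [CharZero K] (s : K) (d : ℤ) (h : s ^ 2 = (d : K))
    (hd : d % 4 = 1) : IsIntegral ℤ ((1 + s) / 2) := by
  obtain ⟨k, hk⟩ : ∃ k, d = 4 * k + 1 := ⟨d / 4, by omega⟩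
  refine ⟨Polynomial.X ^ 2 - Polynomial.X - Polynomial.C k, by monicity!, ?_⟩
  rw [hk] at h
  push_cast at h
  simp only [Polynomial.eval₂_sub, Polynomial.eval₂_pow, Polynomial.eval₂_X, Polynomial.eval₂_C,
    algebraMap_int_eq]
  rw [eq_intCast]
  field_simp
  linear_combination h

theorem int_of_sq {K : Type*} [Field K] (s : K) (d : ℤ) (h : s ^ 2 = (d : K)) : IsIntegral ℤ s := by
  apply IsIntegral.of_pow (n := 2) (by norm_num)
  rw [h]
  exact isIntegral_algebraMap (R := ℤ) (A := K) (x := d)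

theorem quad_idx {K : Type*} [Field K] [NumberField K] (hn : Module.finrank ℚ K = 2)
    (s : K) (d : ℤ) (h : s ^ 2 = (d : K)) (hd : d % 4 = 1) (i : Irr s) :
    ∃ m : ℤ, d = m ^ 2 * discr K := by
  obtain ⟨m, hm⟩ := idx hn ![1, (1 + s) / 2] (by
    intro j
    fin_cases j
    · exact isIntegral_one
    · exact half_int s d h hd)
  refine ⟨m, ?_⟩
  have h2 := two s (d : ℚ) (by rw [h]; simp) i
  let P : Matrix (Fin 2) (Fin 2) ℚ := !![1, 0; 1/2, 1/2]
  have hP : ![1, (1 + s) / 2] = Matrix.mulVec (P.map (algebraMap ℚ K)) ![1, s] := by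
    funext j
    fin_cases j <;> simp [P, Matrix.mulVec, dotProduct, Fin.sum_univ_two]
    field_simp
  rw [hP, Algebra.discr_of_matrix_mulVec, h2, hn] at hm
  simp [P, Matrix.det_fin_two] at hm
  have : (d : ℚ) = m ^ 2 * discr K := by
    rw [← hm]
  exact_mod_cast this

theorem quart_odd {K : Type*} [Field K] [NumberField K] (hn : Module.finrank ℚ K = 4)
    (s1 s2 : K) (a b : ℤ) (h1 : s1 ^ 2 = (a : K)) (h2 : s2 ^ 2 = (b : K)) (ha : a % 4 = 1)
    (hb : b % 4 = 1)
    (i1 : Irr s1) (i2 : Irr s2) (i12 : Irr (s1 * s2)) : Odd (discr K) := by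
  obtain ⟨m, hm⟩ := idx hn ![1, (1 + s1) / 2, (1 + s2) / 2, (1 + s1) / 2 * ((1 + s2) / 2)] (by
    intro j
    fin_cases j
    · exact isIntegral_one
    · exact half_int s1 a h1 ha
    · exact half_int s2 b h2 hb
    · exact (half_int s1 a h1 ha).mul (half_int s2 b h2 hb))
  have ha0 : (a : ℚ) ≠ 0 := by
    have : a ≠ 0 := by omega
    exact_mod_cast this
  have hb0 : (b : ℚ) ≠ 0 := by
    have : b ≠ 0 := by omega
    exact_mod_cast this
  have h4 := four s1 s2 (s1 * s2) (a : ℚ) (b : ℚ) (a * b : ℚ) (by rw [h1]; simp) (by rw [h2]; simp)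
    (by rw [mul_pow, h1, h2]; simp) i1 i2 i12 i12
    (by
      rw [show s1 * (s1 * s2) = algebraMap ℚ K a * s2 by rw [← mul_assoc, ← sq, h1]; simp]
      exact i2.smul_mul ha0)
    (by
      rw [show s2 * (s1 * s2) = algebraMap ℚ K b * s1 by
        rw [mul_comm s1, ← mul_assoc, ← sq, h2]; simp]
      exact i1.smul_mul hb0)
  let P : Matrix (Fin 4) (Fin 4) ℚ := !![1, 0, 0, 0; 1/2, 1/2, 0, 0; 1/2, 0, 1/2, 0; 1/4,1/4,1/4,1/4]
  have hP : ![1, (1 + s1) / 2, (1 + s2) / 2, (1 + s1) / 2 * ((1 + s2) / 2)] =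
      Matrix.mulVec (P.map (algebraMap ℚ K)) ![1, s1, s2, s1 * s2] := by
    funext j
    fin_cases j <;> simp [P, Matrix.mulVec, dotProduct, Fin.sum_univ_four] <;> ring
  have hdet : P.det = 1 / 16 := by
    rw [Matrix.det_of_isLowerTriangular]
    · simp [P, Fin.prod_univ_four]; norm_num
    · intro i j hij
      replace hij : i < j := hij
      fin_cases i <;> fin_cases j <;> simp [P] at hij ⊢
  rw [hP, Algebra.discr_of_matrix_mulVec, h4, hn, hdet] at hm
  have : a ^ 2 * b ^ 2 = m ^ 2 * discr K := by
    have : (a ^ 2 * b ^ 2 : ℚ) = m ^ 2 * discr K := by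
      rw [← hm]; ring
    exact_mod_cast this
  have ho : Odd (a ^ 2 * b ^ 2) := by
    have h1 : Odd a := Int.odd_iff.2 (by omega)
    have h2 : Odd b := Int.odd_iff.2 (by omega)
    exact h1.pow.mul h2.pow
  rw [this, Int.odd_mul] at ho
  exact ho.2

theorem discr_pow_dvd (K L : Type*) [Field K] [NumberField K] [Field L] [NumberField L] [Algebra K L] :
    discr K ^ Module.finrank K L ∣ discr L := by
  rw [← Int.dvd_natAbs, natAbs_discr_eq_absNorm_differentIdeal_mul_natAbs_discr_pow K (𝓞 K) L (𝓞 L),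
    Nat.cast_mul, Nat.cast_pow, ← Int.mul_sign_self, mul_pow, ← mul_assoc,
    mul_comm _ (discr K ^ _), mul_assoc]
  exact Int.dvd_mul_right _ _
end

section
open NumberField

theorem exists_sqrt {K : Type*} [Field K] [NumberField K] (hn : Module.finrank ℚ K = 2) :
    ∃ (y : K) (q : ℚ), y ^ 2 = algebraMap ℚ K q ∧ Irr y := by
  obtain ⟨x, hx⟩ : ∃ x : K, Irr x := by
    by_contra! hc
    have : Module.finrank ℚ K ≤ 1 := by
      apply finrank_le_one (1 : K)
      intro w
      have := hc w
      simp only [Irr, not_forall, not_not, ne_eq] at this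
      obtain ⟨r, hr⟩ := this
      exact ⟨r, by rw [← hr, Algebra.smul_def, mul_one]⟩
    omega
  let f := Algebra.lmul ℚ K x
  have h1 := LinearMap.aeval_self_charpoly f
  have h2 : f.charpoly.natDegree = 2 := by rw [LinearMap.charpoly_natDegree, hn]
  have h3 := (LinearMap.charpoly_monic f).as_sum
  rw [h2] at h3
  simp only [Finset.sum_range_succ, Finset.sum_range_zero, zero_add, pow_zero, pow_one, mul_one] at h3
  set c := f.charpoly.coeff 0
  set b := f.charpoly.coeff 1
  rw [h3] at h1
  have h4 := congrArg (fun g : Module.End ℚ K => g 1) h1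
  simp [f, sq, Algebra.smul_def] at h4
  refine ⟨x + algebraMap ℚ K (b / 2), b ^ 2 / 4 - c, ?_, ?_⟩
  · simp
    linear_combination h4
  · intro r hr
    apply hx (r - b / 2)
    rw [map_sub, hr]; ring

theorem rat_of_int {K : Type*} [Field K] [Algebra ℚ K] (q : ℚ) (h : IsIntegral ℤ (algebraMap ℚ K q)) :
    ∃ z : ℤ, (z : ℚ) = q := by
  have : IsIntegral ℤ q := (isIntegral_algebraMap_iff (algebraMap ℚ K).injective).1 h
  obtain ⟨z, hz⟩ := IsIntegrallyClosed.isIntegral_iff.1 this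
  exact ⟨z, by simpa using hz⟩

theorem quad_struct {K : Type*} [Field K] [NumberField K] (hn : Module.finrank ℚ K = 2)
    (ho : Odd (discr K)) : ∃ s : K, s ^ 2 = (discr K : K) ∧ Irr s ∧ discr K % 4 = 1 ∧
      Squarefree (discr K) := by
  obtain ⟨y, q, hy, iy⟩ := exists_sqrt hn
  have hq : q ≠ 0 := by
    rintro rfl; simp at hy; exact iy.ne_zero hy
  have ty := tr_zero y q hy iy
  have h2 := two y q hy iy
  rw [hn] at h2
  have hli : LinearIndependent ℚ ![1, y] := by
    by_contra hc
    rw [Algebra.discr_zero_of_not_linearIndependent ℚ hc] at h2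
    apply hq
    have : (q : ℚ) * 4 = 0 := by rw [show (0:ℚ) = _ from h2]; push_cast; ring
    linarith
  let Y := basisOfLinearIndependentOfCardEqFinrank hli (by rw [hn]; simp)
  have hY : ∀ z : K, ∃ u v : ℚ, z = algebraMap ℚ K u + algebraMap ℚ K v * y := by
    intro z
    have := Y.sum_repr z
    refine ⟨Y.repr z 0, Y.repr z 1, ?_⟩
    conv_lhs => rw [← this]
    simp [Fin.sum_univ_two, Y, Algebra.smul_def]
  have htr : ∀ u v : ℚ, Algebra.trace ℚ K (algebraMap ℚ K u + algebraMap ℚ K v * y) = 2 * u := by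
    intro u v
    rw [map_add, Algebra.trace_algebraMap, ← Algebra.smul_def, map_smul, ty, hn]
    simp
  have hInteg : ∀ u v : ℚ, IsIntegral ℤ (algebraMap ℚ K u + algebraMap ℚ K v * y) →
      ∃ t n : ℤ, (t : ℚ) = 2 * u ∧ (n : ℚ) = u ^ 2 - q * v ^ 2 := by
    intro u v hz
    have := Algebra.isIntegral_trace (L := ℚ) hz
    rw [htr] at this
    obtain ⟨t, ht⟩ := IsIntegrallyClosed.isIntegral_iff.1 this
    have ht : (t : ℚ) = 2 * u := by simpa using ht
    refine ⟨t, ?_⟩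
    have h3 : IsIntegral ℤ (algebraMap ℚ K (u ^ 2 - q * v ^ 2)) := by
      have : algebraMap ℚ K (u ^ 2 - q * v ^ 2) = (algebraMap ℚ K u + algebraMap ℚ K v * y) *
          (algebraMap ℤ K t - (algebraMap ℚ K u + algebraMap ℚ K v * y)) := by
        have : algebraMap ℤ K t = 2 * algebraMap ℚ K u := by
          rw [IsScalarTower.algebraMap_apply ℤ ℚ K]
          rw [show algebraMap ℤ ℚ t = (t : ℚ) from rfl, ht]; simp
        rw [this, map_sub, map_mul, map_pow, map_pow, ← hy]; ring
      rw [this]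
      exact hz.mul (isIntegral_algebraMap.sub hz)
    obtain ⟨n, hn⟩ := rat_of_int _ h3
    exact ⟨n, ht, hn⟩
  have hc : Fintype.card (Module.Free.ChooseBasisIndex ℤ (𝓞 K)) = 2 := by
    rw [← hn, ← RingOfIntegers.rank K, Module.finrank_eq_card_chooseBasisIndex]
  let e := Fintype.equivFinOfCardEq hc
  let B' := (integralBasis K).reindex e
  have hBi : ∀ i, IsIntegral ℤ (B' i) := by
    intro i
    simp only [B', Module.Basis.reindex_apply, integralBasis_apply]
    exact RingOfIntegers.isIntegral_coe _
  have hD : (discr K : ℚ) = Algebra.discr ℚ B' := by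
    rw [coe_discr, ← Algebra.discr_reindex ℚ (integralBasis K) e]
    congr 1
    funext i; simp [B']
  obtain ⟨u0, v0, e0⟩ := hY (B' 0)
  obtain ⟨u1, v1, e1⟩ := hY (B' 1)
  let P : Matrix (Fin 2) (Fin 2) ℚ := !![u0, v0; u1, v1]
  have hP : (B' : Fin 2 → K) = Matrix.mulVec (P.map (algebraMap ℚ K)) ![1, y] := by
    funext j
    fin_cases j
    · simp [P, Matrix.mulVec, dotProduct, Fin.sum_univ_two, e0]
    · simp [P, Matrix.mulVec, dotProduct, Fin.sum_univ_two, e1]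
  rw [hP, Algebra.discr_of_matrix_mulVec, h2] at hD
  simp only [P, Matrix.det_fin_two_of] at hD
  have hDne := discr_ne_zero K
  obtain ⟨t0, n0, ht0, hn0⟩ := hInteg u0 v0 (e0 ▸ hBi 0)
  obtain ⟨t1, n1, ht1, hn1⟩ := hInteg u1 v1 (e1 ▸ hBi 1)
  obtain ⟨w, -, hw, -⟩ := hInteg (u0 * u1 + q * v0 * v1) (u0 * v1 + u1 * v0) (by
    have := (hBi 0).mul (hBi 1)
    rw [e0, e1] at this
    convert! this using 1
    simp only [map_add, map_mul]
    rw [← hy]; ring)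
  have hDz : discr K = (t0 * t1 - w) ^ 2 - 4 * (n0 * n1) := by
    have : (discr K : ℚ) = (t0 * t1 - w) ^ 2 - 4 * (n0 * n1) := by
      rw [hD, ht0, ht1, hw, hn0, hn1]; push_cast; ring
    exact_mod_cast this
  have hmod : discr K % 4 = 1 := by
    have h5 : Odd ((t0 * t1 - w) ^ 2) := by
      have : (t0 * t1 - w) ^ 2 = discr K + 4 * (n0 * n1) := by rw [hDz]; ring
      rw [this]
      exact ho.add_even ⟨2 * (n0 * n1), by ring⟩
    have h6 : Odd (t0 * t1 - w) := by
      rcases Int.even_or_odd (t0 * t1 - w) with h | h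
      · exact absurd (h.pow_of_ne_zero two_ne_zero) (Int.not_even_iff_odd.2 h5)
      · exact h
    have := Int.sq_mod_four_eq_one_of_odd h6
    omega
  have hdet : 2 * (u0 * v1 - v0 * u1) ≠ 0 := by
    intro h0
    have : u0 * v1 - v0 * u1 = 0 := by linarith
    rw [this] at hD
    simp at hD
    exact hDne hD
  have hs : (algebraMap ℚ K (2 * (u0 * v1 - v0 * u1)) * y) ^ 2 = (discr K : K) := by
    rw [mul_pow, hy, ← map_pow, ← map_mul]
    rw [show (discr K : K) = algebraMap ℚ K (discr K : ℚ) by simp, hD]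
    congr 1
    push_cast; ring
  have is := iy.smul_mul hdet
  refine ⟨_, hs, is, hmod, ?_⟩
  set s := algebraMap ℚ K (2 * (u0 * v1 - v0 * u1)) * y
  rintro k ⟨D', hk⟩
  have hk0 : k ≠ 0 := by
    rintro rfl; simp at hk; exact hDne hk
  have hkK : (k : K) ≠ 0 := by exact_mod_cast hk0
  have hko : Odd k := by
    rw [hk, Int.odd_mul, Int.odd_mul] at ho; exact ho.1.1
  have hD' : D' % 4 = 1 := by
    have h7 := Int.sq_mod_four_eq_one_of_odd hko
    rw [hk, ← sq, Int.mul_emod, h7] at hmod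
    omega
  obtain ⟨m, hm⟩ := quad_idx hn (algebraMap ℚ K (1 / k) * s) D' (by
    rw [mul_pow, hs, hk]
    simp
    field_simp) hD' (is.smul_mul (by simpa using hk0))
  have hD0 : D' ≠ 0 := by omega
  have : D' * 1 = D' * (m ^ 2 * k * k) := by
    rw [mul_one]
    nth_rewrite 1 [hm]
    rw [hk]; ring
  have := mul_left_cancel₀ hD0 this
  exact IsUnit.of_mul_eq_one (m ^ 2 * k) (by linarith)
end

section
theorem sf_mul_sq {a b r : ℕ} (ha : Squarefree a) (hb : Squarefree b) (h : a * b = r ^ 2) : a = b := by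
  have key : ∀ {a b r : ℕ}, Squarefree a → Squarefree b → a * b = r ^ 2 → a ∣ b := by
    intro a b r ha hb h
    have h1 : a ∣ r := (ha.dvd_pow_iff_dvd two_ne_zero).1 ⟨b, h.symm⟩
    obtain ⟨k, rfl⟩ := h1
    have h2 : b = a * (k * k) := by
      have := ha.ne_zero
      apply mul_left_cancel₀ this
      rw [h]; ring
    exact ⟨_, h2⟩
  exact Nat.dvd_antisymm (key ha hb h) (key hb ha (by rw [mul_comm]; exact h))

theorem three_sf {a b c k : ℕ} (ha : Squarefree a) (hb : Squarefree b) (hc : Squarefree c)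
    (h : a * b * c = k ^ 2) : ∃ x y z : ℕ, a = x * y ∧ b = x * z ∧ c = y * z ∧
      Nat.Coprime x y ∧ Nat.Coprime x z ∧ Nat.Coprime y z := by
  have hg : 0 < Nat.gcd a b := Nat.gcd_pos_of_pos_left _ (Nat.pos_of_ne_zero ha.ne_zero)
  obtain ⟨y, z, hyz, h1, h2⟩ := Nat.exists_coprime a b
  set x := Nat.gcd a b
  rw [mul_comm] at h1 h2
  have hxy : Nat.Coprime x y := Nat.coprime_of_squarefree_mul (h1 ▸ ha)
  have hxz : Nat.Coprime x z := Nat.coprime_of_squarefree_mul (h2 ▸ hb)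
  refine ⟨x, y, z, h1, h2, ?_, hxy, hxz, hyz⟩
  have hy : Squarefree y := ha.squarefree_of_dvd ⟨x, by rw [mul_comm]; exact h1⟩
  have hz : Squarefree z := hb.squarefree_of_dvd ⟨x, by rw [mul_comm]; exact h2⟩
  have hs : Squarefree (y * z) := (Nat.squarefree_mul hyz).2 ⟨hy, hz⟩
  have hxk : x ∣ k := by
    rw [← Nat.pow_dvd_pow_iff two_ne_zero]
    refine ⟨y * z * c, ?_⟩
    rw [← h]
    conv_lhs => rw [h1, h2]
    ring
  obtain ⟨j, rfl⟩ := hxk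
  symm
  apply sf_mul_sq (r := j) hs hc
  have : x ^ 2 ≠ 0 := by positivity
  apply mul_left_cancel₀ this
  rw [← mul_pow, ← h]
  conv_rhs => rw [h1, h2]
  ring

/-- fundamental odd discriminants other than 1 -/
def Fd (d : ℤ) : Prop := Squarefree d ∧ d % 4 = 1 ∧ d ≠ 1

theorem Fd.sf {d : ℤ} (h : Fd d) : Squarefree d.natAbs := Int.squarefree_natAbs.2 h.1

theorem Fd.eq_of_abs {a b : ℤ} (ha : Fd a) (hb : Fd b) (h : a.natAbs = b.natAbs) : a = b := by
  have := ha.2.1; have := hb.2.1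
  omega

theorem Fd.eq_of_sq {a b k : ℤ} (ha : Fd a) (hb : Fd b) (h : a * b = k ^ 2) : a = b := by
  apply ha.eq_of_abs hb
  apply sf_mul_sq (r := k.natAbs) ha.sf hb.sf
  rw [← Int.natAbs_mul, h, Int.natAbs_pow]

theorem Fd.not_sq {a k : ℤ} (ha : Fd a) (h : a = k ^ 2) : False := by
  have := Int.isUnit_iff.1 (ha.1 k ⟨1, by rw [h]; ring⟩)
  apply ha.2.2
  rw [h]
  rcases this with rfl | rfl <;> norm_num

theorem rat_sq {d : ℤ} {r : ℚ} (h : r ^ 2 = d) : ∃ k : ℤ, d = k ^ 2 := by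
  have : IsSquare (d : ℚ) := ⟨r, by rw [← h]; ring⟩
  rw [Rat.isSquare_intCast_iff] at this
  obtain ⟨k, hk⟩ := this
  exact ⟨k, by rw [hk]; ring⟩

/-- the final discriminant computation -/
theorem disc_arith {a b c k n Δ : ℤ} (ha : Fd a) (hb : Fd b) (hc : Fd c)
    (hk : a * b * c = k ^ 2) (hΔ : Odd Δ) (hn : 256 * (a * b * c) = n ^ 2 * Δ)
    (ha2 : a ^ 2 ∣ Δ) (hb2 : b ^ 2 ∣ Δ) (hc2 : c ^ 2 ∣ Δ) : Δ = a * b * c := by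
  have ha0 : a ≠ 0 := ha.1.ne_zero
  have hb0 : b ≠ 0 := hb.1.ne_zero
  have hc0 : c ≠ 0 := hc.1.ne_zero
  have hn0 : n ≠ 0 := by
    rintro rfl
    have : a * b * c ≠ 0 := mul_ne_zero (mul_ne_zero ha0 hb0) hc0
    simp at hn
    simp_all
  have h1 : n ^ 2 ∣ (16 * k) ^ 2 := ⟨Δ, by rw [← hn, hk]; ring⟩
  rw [Int.pow_dvd_pow_iff two_ne_zero] at h1
  obtain ⟨e, he⟩ := h1
  have hΔe : Δ = e ^ 2 := by
    have : n ^ 2 ≠ 0 := pow_ne_zero _ hn0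
    apply mul_left_cancel₀ this
    rw [← hn, hk, ← mul_pow, ← he]; ring
  subst hΔe
  have hee : Odd e := by
    rcases Int.even_or_odd e with h | h
    · exact absurd (h.pow_of_ne_zero two_ne_zero) (Int.not_even_iff_odd.2 hΔ)
    · exact h
  rw [Int.pow_dvd_pow_iff two_ne_zero] at ha2 hb2 hc2
  have hek : e ∣ k := by
    have h3 : e ∣ 16 * k := ⟨n, by rw [he]; ring⟩
    have h4 : IsCoprime e 16 := by
      have : IsCoprime e ((2:ℤ) ^ 4) := by
        apply IsCoprime.pow_right
        obtain ⟨j, hj⟩ := hee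
        exact ⟨1, -j, by rw [hj]; ring⟩
      simpa using this
    exact h4.dvd_of_dvd_mul_left h3
  have hke : k ∣ e := by
    obtain ⟨x, y, z, h5, h6, h7, hxy, hxz, hyz⟩ := three_sf (k := k.natAbs) ha.sf hb.sf hc.sf (by
      rw [← Int.natAbs_mul, ← Int.natAbs_mul, hk, Int.natAbs_pow])
    have hkx : k.natAbs = x * y * z := by
      have : k.natAbs ^ 2 = (x * y * z) ^ 2 := by
        rw [← Int.natAbs_pow, ← hk, Int.natAbs_mul, Int.natAbs_mul, h5, h6, h7]; ring
      exact Nat.pow_left_injective two_ne_zero this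
    rw [← Int.natAbs_dvd_natAbs] at ha2 hb2 ⊢
    rw [h5] at ha2
    rw [h6] at hb2
    rw [hkx]
    apply Nat.Coprime.mul_dvd_of_dvd_of_dvd _ ha2 (dvd_of_mul_left_dvd hb2)
    exact Nat.Coprime.mul_left hxz hyz
  rw [hk]
  exact Int.natAbs_eq_iff_sq_eq.1 (Nat.dvd_antisymm (Int.natAbs_dvd_natAbs.2 hek) (Int.natAbs_dvd_natAbs.2 hke))
end

section
open NumberField

theorem quartDisc_eq (K : IntermediateField ℚ ℂ) [NumberField K] : quartDisc K = discr K := by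
  unfold quartDisc
  rw [dif_pos (inferInstance : FiniteDimensional ℚ K)]

theorem irr_coe {K : IntermediateField ℚ ℂ} {x : K} : Irr (x : ℂ) ↔ Irr x := by
  constructor
  · intro h r hr
    apply h r
    rw [← hr]; rfl
  · intro h r hr
    apply h r
    apply Subtype.ext
    rw [← hr]; rfl

theorem Fd.irr {d : ℤ} (hd : Fd d) {K : Type*} [Field K] [Algebra ℚ K] {s : K} (h : s ^ 2 = (d : K)) :
    Irr s := by
  intro r hr
  rw [← hr, ← map_pow] at h
  have : r ^ 2 = (d : ℚ) := by
    apply (algebraMap ℚ K).injective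
    rw [h]; simp
  obtain ⟨k, hk⟩ := rat_sq this
  exact hd.not_sq hk

theorem rat_sq_of_irr {d : ℤ} {K : Type*} [Field K] [Algebra ℚ K] {s : K} (h : s ^ 2 = (d : K))
    (hs : ¬ Irr s) : ∃ k : ℤ, d = k ^ 2 := by
  simp only [Irr, not_forall, not_not, ne_eq] at hs
  obtain ⟨r, hr⟩ := hs
  rw [← hr, ← map_pow] at h
  have : r ^ 2 = (d : ℚ) := by
    apply (algebraMap ℚ K).injective
    rw [h]; simp
  exact rat_sq this

theorem Fd.irr_mul {a b : ℤ} (ha : Fd a) (hb : Fd b) (hab : a ≠ b) {K : Type*} [Field K] [Algebra ℚ K]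
    {s t : K} (h : s ^ 2 = (a : K)) (h' : t ^ 2 = (b : K)) : Irr (s * t) := by
  by_contra hc
  obtain ⟨k, hk⟩ := rat_sq_of_irr (d := a * b) (by rw [mul_pow, h, h']; simp) hc
  exact hab (ha.eq_of_sq hb hk)

/-- ℚ(√d) -/
noncomputable def Qd (d : ℤ) : IntermediateField ℚ ℂ := IntermediateField.adjoin ℚ {z : ℂ | z ^ 2 = (d : ℂ)}

theorem exists_root (d : ℤ) : ∃ s : ℂ, s ^ 2 = (d : ℂ) :=
  IsAlgClosed.exists_pow_nat_eq _ (by norm_num)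

theorem mem_Qd {d : ℤ} {s : ℂ} (h : s ^ 2 = (d : ℂ)) : s ∈ Qd d :=
  IntermediateField.subset_adjoin _ _ h

theorem Qd_le {d : ℤ} {s : ℂ} (h : s ^ 2 = (d : ℂ)) {K : IntermediateField ℚ ℂ} (hs : s ∈ K) : Qd d ≤ K := by
  apply IntermediateField.adjoin_le_iff.2
  intro z hz
  have hz : z ^ 2 = (d : ℂ) := hz
  rcases sq_eq_sq_iff_eq_or_eq_neg.1 (hz.trans h.symm) with rfl | rfl
  · exact hs
  · exact neg_mem hs

theorem Qd_eq {d : ℤ} {s : ℂ} (h : s ^ 2 = (d : ℂ)) : Qd d = IntermediateField.adjoin ℚ {s} := by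
  apply le_antisymm
  · exact Qd_le h (IntermediateField.subset_adjoin _ _ rfl)
  · apply IntermediateField.adjoin_le_iff.2
    rintro z rfl
    exact mem_Qd h

theorem finrank_Qd {d : ℤ} (hd : Fd d) : Module.finrank ℚ (Qd d) = 2 := by
  obtain ⟨s, h⟩ := exists_root d
  have i := hd.irr h
  have hm : minpoly ℚ s = Polynomial.X ^ 2 - Polynomial.C (d : ℚ) := by
    symm
    apply minpoly.eq_of_irreducible_of_monic
    · rw [X_pow_sub_C_irreducible_iff_of_prime Nat.prime_two]
      intro b hb
      obtain ⟨k, hk⟩ := rat_sq hb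
      exact hd.not_sq hk
    · simp [h]
    · exact Polynomial.monic_X_pow_sub_C _ two_ne_zero
  have hInteg : IsIntegral ℚ s := (int_of_sq s d h).tower_top
  rw [Qd_eq h, IntermediateField.adjoin.finrank hInteg, hm, Polynomial.natDegree_X_pow_sub_C]

theorem nf {K : IntermediateField ℚ ℂ} {n : ℕ} (h : Module.finrank ℚ K = n + 1) : NumberField K :=
  { to_charZero := charZero_of_injective_algebraMap (algebraMap ℚ K).injective
    to_finiteDimensional := Module.finite_of_finrank_eq_succ h }

theorem quartDisc_Qd {d : ℤ} (hd : Fd d) : quartDisc (Qd d) = d := by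
  have hf := finrank_Qd hd
  have := nf hf
  rw [quartDisc_eq]
  obtain ⟨s, h⟩ := exists_root d
  let s' : Qd d := ⟨s, mem_Qd h⟩
  have h' : s' ^ 2 = (d : Qd d) := by
    apply Subtype.ext; simpa [s'] using h
  obtain ⟨m, hm⟩ := quad_idx hf s' d h' hd.2.1 (hd.irr h')
  have := Int.isUnit_iff.1 (hd.1 m ⟨discr (Qd d), by rw [← sq]; exact hm⟩)
  have hm2 : m ^ 2 = 1 := by rcases this with h | h <;> rw [h] <;> ring
  rw [hm2, one_mul] at hm
  exact hm.symm

theorem quad_eq_Qd {F : IntermediateField ℚ ℂ} (hF : Module.finrank ℚ F = 2) (ho : Odd (quartDisc F)) :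
    Fd (quartDisc F) ∧ F = Qd (quartDisc F) := by
  have := nf hF
  rw [quartDisc_eq] at ho ⊢
  obtain ⟨s, h, i, h4, hsf⟩ := quad_struct hF ho
  have hfd : Fd (discr F) := by
    refine ⟨hsf, h4, ?_⟩
    intro h1
    rw [h1] at h
    have : (s - 1) * (s + 1) = 0 := by
      push_cast at h; linear_combination h
    rcases mul_eq_zero.1 this with h2 | h2
    · exact i 1 (by simp; linear_combination -h2)
    · exact i (-1) (by simp; linear_combination -h2)
  refine ⟨hfd, ?_⟩
  symm
  have hs : (s : ℂ) ^ 2 = ((discr F : ℤ) : ℂ) := by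
    have := congrArg (fun x : F => (x : ℂ)) h
    simpa using this
  exact IntermediateField.eq_of_le_of_finrank_eq (Qd_le hs s.2) (by rw [finrank_Qd hfd, hF])
end

section
open NumberField

theorem lift_root {K : IntermediateField ℚ ℂ} {d : ℤ} (hK : Qd d ≤ K) : ∃ s : K, s ^ 2 = (d : K) := by
  obtain ⟨s, h⟩ := exists_root d
  refine ⟨⟨s, hK (mem_Qd h)⟩, ?_⟩
  apply Subtype.ext
  simpa using h

theorem finrank_biquad {a b : ℤ} (ha : Fd a) (hb : Fd b) (hab : a ≠ b) :
    Module.finrank ℚ ↥(Qd a ⊔ Qd b) = 4 := by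
  have hfa := finrank_Qd ha
  have hfb := finrank_Qd hb
  have := nf hfa
  have := nf hfb
  apply le_antisymm
  · have := IntermediateField.finrank_sup_le (Qd a) (Qd b)
    rw [hfa, hfb] at this
    omega
  · obtain ⟨s, hs⟩ := lift_root (K := Qd a ⊔ Qd b) (d := a) le_sup_left
    obtain ⟨t, ht⟩ := lift_root (K := Qd a ⊔ Qd b) (d := b) le_sup_right
    have ha0 : (a : ℚ) ≠ 0 := by exact_mod_cast ha.1.ne_zero
    have hb0 : (b : ℚ) ≠ 0 := by exact_mod_cast hb.1.ne_zero
    have ist := ha.irr_mul hb hab hs ht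
    have hfin : FiniteDimensional ℚ ↥(Qd a ⊔ Qd b) := inferInstance
    have h4 := four s t (s * t) (a : ℚ) (b : ℚ) (a * b : ℚ) (by rw [hs]; simp) (by rw [ht]; simp)
      (by rw [mul_pow, hs, ht]; simp) (ha.irr hs) (hb.irr ht) ist ist
      (by
        rw [show s * (s * t) = algebraMap ℚ _ a * t by rw [← mul_assoc, ← sq, hs]; simp]
        exact (hb.irr ht).smul_mul ha0)
      (by
        rw [show t * (s * t) = algebraMap ℚ _ b * s by
          rw [mul_comm s, ← mul_assoc, ← sq, ht]; simp]
        exact (ha.irr hs).smul_mul hb0)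
    have hli : LinearIndependent ℚ ![1, s, t, s * t] := by
      by_contra hc
      rw [Algebra.discr_zero_of_not_linearIndependent ℚ hc] at h4
      have hpos : (Module.finrank ℚ ↥(Qd a ⊔ Qd b) : ℚ) ≠ 0 := by
        have := Module.finrank_pos (R := ℚ) (M := ↥(Qd a ⊔ Qd b))
        exact_mod_cast this.ne'
      have : (Module.finrank ℚ ↥(Qd a ⊔ Qd b) : ℚ) ^ 4 * (a * b * (a * b) : ℚ) ≠ 0 := by positivity
      exact this h4.symm
    have := hli.fintype_card_le_finrank
    simpa using this

theorem biquad_odd {a b : ℤ} (ha : Fd a) (hb : Fd b) (hab : a ≠ b) :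
    Odd (quartDisc (Qd a ⊔ Qd b)) := by
  have hf := finrank_biquad ha hb hab
  have := nf hf
  obtain ⟨s, hs⟩ := lift_root (K := Qd a ⊔ Qd b) (d := a) le_sup_left
  obtain ⟨t, ht⟩ := lift_root (K := Qd a ⊔ Qd b) (d := b) le_sup_right
  rw [quartDisc_eq]
  exact quart_odd hf s t a b hs ht ha.2.1 hb.2.1 (ha.irr hs) (hb.irr ht) (ha.irr_mul hb hab hs ht)

theorem normal_sup' (a b : ℤ) (n1 : Normal ℚ (Qd a)) (n2 : Normal ℚ (Qd b)) : Normal ℚ ↥(Qd a ⊔ Qd b) := by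
  have := @IntermediateField.normal_sup ℚ ℂ _ _ _ (Qd a) (Qd b) (by convert! n1) (by convert! n2)
  convert! this

theorem biquad_V4 {a b : ℤ} (ha : Fd a) (hb : Fd b) (hab : a ≠ b) :
    IsV4Quartic (Qd a ⊔ Qd b) := by
  have hf := finrank_biquad ha hb hab
  have hfa := finrank_Qd ha
  have hfb := finrank_Qd hb
  have q1 : Algebra.IsQuadraticExtension ℚ (Qd a) := { finrank_eq_two' := hfa }
  have q2 : Algebra.IsQuadraticExtension ℚ (Qd b) := { finrank_eq_two' := hfb }
  have n1 : Normal ℚ (Qd a) := inferInstance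
  have n2 : Normal ℚ (Qd b) := inferInstance
  have n3 : Normal ℚ ↥(Qd a ⊔ Qd b) := normal_sup' a b n1 n2
  have := nf hf
  have hG : IsGalois ℚ ↥(Qd a ⊔ Qd b) := {
    to_isSeparable := inferInstance
    to_normal := n3 }
  refine ⟨hf, hG, ?_⟩
  have hcard : Nat.card (↥(Qd a ⊔ Qd b) ≃ₐ[ℚ] ↥(Qd a ⊔ Qd b)) = 4 := by
    rw [IsGalois.card_aut_eq_finrank, hf]
  have hsq : ∀ σ : (↥(Qd a ⊔ Qd b) ≃ₐ[ℚ] ↥(Qd a ⊔ Qd b)), σ ^ 2 = 1 := by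
    intro σ
    have hroot : ∀ (d : ℤ) (s : ↥(Qd a ⊔ Qd b)), s ^ 2 = (d : ↥(Qd a ⊔ Qd b)) → σ (σ s) = s := by
      intro d s hs
      have h1 : (σ s) ^ 2 = s ^ 2 := by rw [← map_pow, hs]; simp
      rcases sq_eq_sq_iff_eq_or_eq_neg.1 h1 with h | h
      · rw [h, h]
      · rw [h, map_neg, h, neg_neg]
    let E : IntermediateField ℚ ↥(Qd a ⊔ Qd b) := IntermediateField.fixedField (Subgroup.zpowers (σ ^ 2))
    have hE : ∀ x : ↥(Qd a ⊔ Qd b), x ∈ E → σ (σ x) = x := by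
      intro x hx
      exact hx ⟨σ ^ 2, Subgroup.mem_zpowers _⟩
    have hE' : ∀ x : ↥(Qd a ⊔ Qd b), σ (σ x) = x → x ∈ E := by
      rintro x hx ⟨g, hg⟩
      have h3 : σ ^ 2 ∈ MulAction.stabilizer (↥(Qd a ⊔ Qd b) ≃ₐ[ℚ] ↥(Qd a ⊔ Qd b)) x := hx
      exact (Subgroup.zpowers_le.2 h3) hg
    have hle : Qd a ⊔ Qd b ≤ IntermediateField.lift E := by
      obtain ⟨s, hs⟩ := lift_root (K := Qd a ⊔ Qd b) (d := a) le_sup_left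
      obtain ⟨t, ht⟩ := lift_root (K := Qd a ⊔ Qd b) (d := b) le_sup_right
      apply sup_le
      · apply Qd_le (s := (s : ℂ))
        · have := congrArg (fun x : ↥(Qd a ⊔ Qd b) => (x : ℂ)) hs
          simpa using this
        · exact (IntermediateField.mem_lift s).2 (hE' s (hroot a s hs))
      · apply Qd_le (s := (t : ℂ))
        · have := congrArg (fun x : ↥(Qd a ⊔ Qd b) => (x : ℂ)) ht
          simpa using this
        · exact (IntermediateField.mem_lift t).2 (hE' t (hroot b t ht))
    ext x
    have hx := (IntermediateField.mem_lift x).1 (hle x.2)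
    have := hE x hx
    exact congrArg _ this
  have hexp : Monoid.exponent (↥(Qd a ⊔ Qd b) ≃ₐ[ℚ] ↥(Qd a ⊔ Qd b)) = 2 := by
    have h2 := Monoid.exponent_dvd_of_forall_pow_eq_one hsq
    rcases (Nat.dvd_prime Nat.prime_two).1 h2 with h | h
    · have := Monoid.exp_eq_one_iff.1 h
      rw [Nat.card_eq_one_iff_unique.2 ⟨this, ⟨1⟩⟩] at hcard
      omega
    · exact h
  have hK : IsKleinFour (↥(Qd a ⊔ Qd b) ≃ₐ[ℚ] ↥(Qd a ⊔ Qd b)) := ⟨hcard, hexp⟩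
  exact IsKleinFour.nonempty_mulEquiv

theorem third {K : IntermediateField ℚ ℂ} (hK : Module.finrank ℚ K = 4) {a b c : ℤ} (ha : Fd a)
    (hb : Fd b) (hc : Fd c) (hab : a ≠ b) (hac : a ≠ c) (hbc : b ≠ c) (la : Qd a ≤ K) (lb : Qd b ≤ K)
    (lc : Qd c ≤ K) : ∃ k : ℤ, a * b * c = k ^ 2 := by
  have := nf hK
  obtain ⟨s, hs⟩ := lift_root la
  obtain ⟨t, ht⟩ := lift_root lb
  obtain ⟨u, hu⟩ := lift_root lc
  by_cases h : Irr (s * t * u)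
  · exact (five hK s t u (a : ℚ) (b : ℚ) (c : ℚ) (by rw [hs]; simp) (by rw [ht]; simp)
      (by rw [hu]; simp) (ha.irr hs) (hb.irr ht) (ha.irr_mul hb hab hs ht) (hc.irr hu)
      (ha.irr_mul hc hac hs hu) (hb.irr_mul hc hbc ht hu) h).elim
  · exact rat_sq_of_irr (by rw [mul_pow, mul_pow, hs, ht, hu]; simp) h

theorem quad_disc_dvd {K F : IntermediateField ℚ ℂ} (hK : Module.finrank ℚ K = 4)
    (hF : Module.finrank ℚ F = 2) (h : F ≤ K) : quartDisc F ^ 2 ∣ quartDisc K := by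
  have := nf hK
  have := nf hF
  rw [quartDisc_eq, quartDisc_eq]
  let _ : Algebra F K := (IntermediateField.inclusion h).toRingHom.toAlgebra
  have : IsScalarTower ℚ F K := IsScalarTower.of_algebraMap_eq' (by ext; rfl)
  have h1 := discr_pow_dvd F K
  have h2 := Module.finrank_mul_finrank ℚ F K
  rw [hF, hK] at h2
  rwa [show Module.finrank F K = 2 by omega] at h1

theorem biquad_disc {K : IntermediateField ℚ ℂ} (hK : Module.finrank ℚ K = 4) (ho : Odd (quartDisc K))
    {a b c : ℤ} (ha : Fd a)
    (hb : Fd b) (hc : Fd c) (hab : a ≠ b) (hac : a ≠ c) (hbc : b ≠ c) (la : Qd a ≤ K) (lb : Qd b ≤ K)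
    (lc : Qd c ≤ K) : quartDisc K = a * b * c := by
  obtain ⟨k, hk⟩ := third hK ha hb hc hab hac hbc la lb lc
  have da := quad_disc_dvd hK (finrank_Qd ha) la
  have db := quad_disc_dvd hK (finrank_Qd hb) lb
  have dc := quad_disc_dvd hK (finrank_Qd hc) lc
  rw [quartDisc_Qd ha] at da
  rw [quartDisc_Qd hb] at db
  rw [quartDisc_Qd hc] at dc
  have := nf hK
  obtain ⟨s, hs⟩ := lift_root la
  obtain ⟨t, ht⟩ := lift_root lb
  obtain ⟨u, hu⟩ := lift_root lc
  have h4 := four s t u (a : ℚ) (b : ℚ) (c : ℚ) (by rw [hs]; simp) (by rw [ht]; simp)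
      (by rw [hu]; simp) (ha.irr hs) (hb.irr ht) (hc.irr hu) (ha.irr_mul hb hab hs ht)
      (ha.irr_mul hc hac hs hu) (hb.irr_mul hc hbc ht hu)
  obtain ⟨n, hn⟩ := idx hK ![1, s, t, u] (by
    intro j
    fin_cases j
    · exact isIntegral_one
    · exact int_of_sq s a hs
    · exact int_of_sq t b ht
    · exact int_of_sq u c hu)
  rw [h4, hK, ← quartDisc_eq] at hn
  have hn' : 256 * (a * b * c) = n ^ 2 * quartDisc K := by
    have : (256 * (a * b * c) : ℚ) = n ^ 2 * quartDisc K := by rw [← hn]; push_cast; ring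
    exact_mod_cast this
  exact disc_arith ha hb hc hk ho hn' da db dc
end

section
open NumberField

theorem good_iff (v : Fin 3 → ℕ) : Good v ↔ (Odd (v 0) ∧ Odd (v 1) ∧ Odd (v 2)) ∧
    (Squarefree (v 0) ∧ Squarefree (v 1) ∧ Squarefree (v 2)) ∧
    (Nat.Coprime (v 0) (v 1) ∧ Nat.Coprime (v 0) (v 2) ∧ Nat.Coprime (v 1) (v 2)) := by
  have h2 : Loc 2 v ↔ (Odd (v 0) ∧ Odd (v 1) ∧ Odd (v 2)) := by
    simp [Loc, Eset, Fin.forall_fin_succ, ← Nat.not_even_iff_odd, even_iff_two_dvd]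
  have hp : ∀ p : ℕ, p ≠ 2 → (Loc p v ↔ (¬ p * p ∣ v 0 ∧ ¬ p * p ∣ v 1 ∧ ¬ p * p ∣ v 2) ∧
      ¬ (p ∣ v 0 ∧ p ∣ v 1) ∧ ¬ (p ∣ v 0 ∧ p ∣ v 2) ∧ ¬ (p ∣ v 1 ∧ p ∣ v 2)) := by
    intro p hp
    simp [Loc, Eset, hp, Fin.forall_fin_succ, ← sq]
    tauto
  have hcop : ∀ m n : ℕ, Nat.Coprime m n ↔ ∀ p, p.Prime → ¬ (p ∣ m ∧ p ∣ n) := by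
    intro m n
    have := @Nat.Prime.not_coprime_iff_dvd m n
    constructor
    · intro h p hp hd
      exact (this.2 ⟨p, hp, hd.1, hd.2⟩) h
    · intro h
      by_contra hc
      obtain ⟨p, hp, h1, h2⟩ := this.1 hc
      exact h p hp ⟨h1, h2⟩
  simp only [Nat.squarefree_iff_prime_squarefree, hcop]
  constructor
  · intro h
    have o := h2.1 (h 2 Nat.prime_two)
    have n0 : ¬ 2 ∣ v 0 := by rw [← even_iff_two_dvd, Nat.not_even_iff_odd]; exact o.1
    have n1 : ¬ 2 ∣ v 1 := by rw [← even_iff_two_dvd, Nat.not_even_iff_odd]; exact o.2.1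
    have n2 : ¬ 2 ∣ v 2 := by rw [← even_iff_two_dvd, Nat.not_even_iff_odd]; exact o.2.2
    have key : ∀ p : ℕ, p.Prime → (¬ p * p ∣ v 0 ∧ ¬ p * p ∣ v 1 ∧ ¬ p * p ∣ v 2) ∧
      ¬ (p ∣ v 0 ∧ p ∣ v 1) ∧ ¬ (p ∣ v 0 ∧ p ∣ v 2) ∧ ¬ (p ∣ v 1 ∧ p ∣ v 2) := by
      intro p hpp
      by_cases hp2 : p = 2
      · subst hp2
        have d : ∀ n, 2 * 2 ∣ n → 2 ∣ n := fun n h => dvd_of_mul_left_dvd h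
        have d0 := d (v 0)
        have d1 := d (v 1)
        have d2 := d (v 2)
        tauto
      · exact (hp p hp2).1 (h p hpp)
    exact ⟨o, ⟨fun p h => (key p h).1.1, fun p h => (key p h).1.2.1, fun p h => (key p h).1.2.2⟩,
      fun p h => (key p h).2.1, fun p h => (key p h).2.2.1, fun p h => (key p h).2.2.2⟩
  · rintro ⟨o, ⟨s0, s1, s2⟩, c01, c02, c12⟩ p hpp
    by_cases hp2 : p = 2
    · subst hp2; exact h2.2 o
    · exact (hp p hp2).2 ⟨⟨s0 p hpp, s1 p hpp, s2 p hpp⟩, c01 p hpp, c02 p hpp, c12 p hpp⟩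

/-- signed version, congruent to 1 mod 4 -/
def star4 (n : ℕ) : ℤ := if n % 4 = 1 then n else -n

theorem star4_natAbs (n : ℕ) : (star4 n).natAbs = n := by
  unfold star4; split_ifs <;> simp

theorem star4_mod {n : ℕ} (h : Odd n) : star4 n % 4 = 1 := by
  obtain ⟨k, rfl⟩ := h
  unfold star4; split_ifs <;> push_cast <;> omega

theorem star4_Fd {n : ℕ} (h : Odd n) (hs : Squarefree n) (h1 : n ≠ 1) : Fd (star4 n) := by
  refine ⟨?_, star4_mod h, ?_⟩
  · rw [← Int.squarefree_natAbs, star4_natAbs]; exact hs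
  · intro h'
    have := star4_natAbs n
    rw [h'] at this
    exact h1 (by simpa using this.symm)

theorem Fd.eq_star4 {d : ℤ} (h : Fd d) : d = star4 d.natAbs := by
  have := h.2.1
  unfold star4; split_ifs <;> omega

theorem star4_mul {x y z : ℕ} (hx : Odd x) (hy : Odd y) (hz : Odd z) :
    star4 (x * y) * star4 (x * z) = x ^ 2 * star4 (y * z) := by
  have h1 := star4_mod (hx.mul hy)
  have h2 := star4_mod (hx.mul hz)
  have h3 := star4_mod (hy.mul hz)
  have h4 : ((x:ℤ)^2) % 4 = 1 := Int.sq_mod_four_eq_one_of_odd (by exact_mod_cast hx)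
  have h5 : (star4 (x * y) * star4 (x * z)).natAbs = ((x:ℤ) ^ 2 * star4 (y * z)).natAbs := by
    rw [Int.natAbs_mul, Int.natAbs_mul, star4_natAbs, star4_natAbs, star4_natAbs, Int.natAbs_pow]
    simp; ring
  have h6 : (star4 (x * y) * star4 (x * z)) % 4 = 1 := by rw [Int.mul_emod, h1, h2]; rfl
  have h7 : ((x:ℤ) ^ 2 * star4 (y * z)) % 4 = 1 := by rw [Int.mul_emod, h4, h3]; rfl
  omega

/-- the field attached to a triple -/
noncomputable def Kof (v : Fin 3 → ℕ) : IntermediateField ℚ ℂ := Qd (star4 (v 0 * v 1)) ⊔ Qd (star4 (v 0 * v 2))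

theorem good_facts {v : Fin 3 → ℕ} (hg : Good v) (h1 : v 0 < v 1) (h2 : v 1 ≤ v 2) :
    v 0 * v 1 < v 0 * v 2 ∧ v 0 * v 2 < v 1 * v 2 ∧ 0 < v 0 ∧
    Fd (star4 (v 0 * v 1)) ∧ Fd (star4 (v 0 * v 2)) ∧ Fd (star4 (v 1 * v 2)) ∧
    Qd (star4 (v 1 * v 2)) ≤ Kof v := by
  obtain ⟨⟨o0, o1, o2⟩, ⟨s0, s1, s2⟩, c01, c02, c12⟩ := (good_iff v).1 hg
  have p0 : 0 < v 0 := o0.pos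
  have h12 : v 1 < v 2 := by
    rcases h2.lt_or_eq with h | h
    · exact h
    · rw [h, Nat.coprime_self] at c12
      omega
  have f0 : v 0 * v 1 ≠ 1 := by
    intro h; have := Nat.eq_one_of_mul_eq_one_left h; omega
  have f1 : v 0 * v 2 ≠ 1 := by
    intro h; have := Nat.eq_one_of_mul_eq_one_left h; omega
  have f2 : v 1 * v 2 ≠ 1 := by
    intro h; have := Nat.eq_one_of_mul_eq_one_left h; omega
  refine ⟨Nat.mul_lt_mul_of_pos_left h12 p0, Nat.mul_lt_mul_of_pos_right h1 (by omega), p0,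
    star4_Fd (o0.mul o1) ((Nat.squarefree_mul c01).2 ⟨s0, s1⟩) f0,
    star4_Fd (o0.mul o2) ((Nat.squarefree_mul c02).2 ⟨s0, s2⟩) f1,
    star4_Fd (o1.mul o2) ((Nat.squarefree_mul c12).2 ⟨s1, s2⟩) f2, ?_⟩
  obtain ⟨s, hs⟩ := exists_root (star4 (v 0 * v 1))
  obtain ⟨t, ht⟩ := exists_root (star4 (v 0 * v 2))
  have p0' : ((v 0 : ℕ) : ℂ) ≠ 0 := by exact_mod_cast p0.ne'
  apply Qd_le (s := s * t / (v 0 : ℂ))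
  · rw [div_pow, mul_pow, hs, ht, ← Int.cast_mul, star4_mul o0 o1 o2]
    push_cast
    field_simp
  · apply div_mem
    · exact mul_mem ((le_sup_left : _ ≤ Kof v) (mem_Qd hs)) ((le_sup_right : _ ≤ Kof v) (mem_Qd ht))
    · exact natCast_mem _ _

theorem star4_inj {m n : ℕ} (h : star4 m = star4 n) : m = n := by
  rw [← star4_natAbs m, h, star4_natAbs]

theorem Kof_inj {v w : Fin 3 → ℕ} (hg : Good v) (h1 : v 0 < v 1) (h2 : v 1 ≤ v 2)
    (hg' : Good w) (h1' : w 0 < w 1) (h2' : w 1 ≤ w 2) (h : Kof v = Kof w) : v = w := by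
  obtain ⟨l1, l2, p0, fa, fb, fc, lc⟩ := good_facts hg h1 h2
  obtain ⟨l1', l2', p0', fa', fb', fc', lc'⟩ := good_facts hg' h1' h2'
  have hab : star4 (v 0 * v 1) ≠ star4 (v 0 * v 2) := fun h => by have := star4_inj h; omega
  have hac : star4 (v 0 * v 1) ≠ star4 (v 1 * v 2) := fun h => by have := star4_inj h; omega
  have hbc : star4 (v 0 * v 2) ≠ star4 (v 1 * v 2) := fun h => by have := star4_inj h; omega
  have hK : Module.finrank ℚ (Kof v) = 4 := finrank_biquad fa fb hab
  obtain ⟨k, hk⟩ := third hK fa fb fc hab hac hbc le_sup_left le_sup_right lc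
  have key : ∀ n : ℕ, Fd (star4 n) → Qd (star4 n) ≤ Kof v → n = v 0 * v 1 ∨ n = v 0 * v 2 ∨ n = v 1 * v 2 := by
    intro n fn ln
    by_cases e1 : star4 (v 0 * v 1) = star4 n
    · exact Or.inl (star4_inj e1).symm
    by_cases e2 : star4 (v 0 * v 2) = star4 n
    · exact Or.inr (Or.inl (star4_inj e2).symm)
    right; right
    obtain ⟨j, hj⟩ := third hK fa fb fn hab e1 e2 le_sup_left le_sup_right ln
    have hne : (star4 (v 0 * v 1) * star4 (v 0 * v 2)) ≠ 0 := mul_ne_zero fa.1.ne_zero fb.1.ne_zero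
    -- c * n is a square
    have h3 : (star4 (v 0 * v 1) * star4 (v 0 * v 2)) ^ 2 ∣ (k * j) ^ 2 :=
      ⟨star4 (v 1 * v 2) * star4 n, by rw [mul_pow, ← hk, ← hj]; ring⟩
    rw [Int.pow_dvd_pow_iff two_ne_zero] at h3
    obtain ⟨i, hi⟩ := h3
    have h4 : star4 (v 1 * v 2) * star4 n = i ^ 2 := by
      apply mul_left_cancel₀ (pow_ne_zero 2 hne)
      linear_combination (star4 (v 0 * v 1) * star4 (v 0 * v 2) * star4 n) * hk + k ^ 2 * hj +
        (k * j + star4 (v 0 * v 1) * star4 (v 0 * v 2) * i) * hi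
    exact (star4_inj (fc.eq_of_sq fn h4)).symm
  have k1 := key _ fa' (h ▸ le_sup_left)
  have k2 := key _ fb' (h ▸ le_sup_right)
  have k3 := key _ fc' (h ▸ lc')
  have m1 : v 0 * v 1 = w 0 * w 1 := by omega
  have m2 : v 0 * v 2 = w 0 * w 2 := by omega
  have m3 : v 1 * v 2 = w 1 * w 2 := by omega
  have hv0 : v 0 = w 0 := by
    have : v 0 ^ 2 * (v 1 * v 2) = w 0 ^ 2 * (v 1 * v 2) := by
      calc v 0 ^ 2 * (v 1 * v 2) = (v 0 * v 1) * (v 0 * v 2) := by ring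
        _ = (w 0 * w 1) * (w 0 * w 2) := by rw [m1, m2]
        _ = w 0 ^ 2 * (w 1 * w 2) := by ring
        _ = _ := by rw [m3]
    have := Nat.eq_of_mul_eq_mul_right (by omega) this
    exact Nat.pow_left_injective two_ne_zero this
  rw [← hv0] at m1 m2
  have hv1 := Nat.eq_of_mul_eq_mul_left p0 m1
  have hv2 := Nat.eq_of_mul_eq_mul_left p0 m2
  funext i
  fin_cases i <;> assumption

/-- the predicate of the statement -/
def Pred (R₁ R₂ X : ℝ) (K : IntermediateField ℚ ℂ) : Prop :=
  IsV4Quartic K ∧ (quartDisc K : ℝ) < X ∧ Odd (quartDisc K) ∧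
            ∃ F₁ F₂ F₃ : IntermediateField ℚ ℂ,
              F₁ ≠ F₂ ∧ F₁ ≠ F₃ ∧ F₂ ≠ F₃ ∧
              IsQuadSubfield K F₁ ∧ IsQuadSubfield K F₂ ∧ IsQuadSubfield K F₃ ∧
              |quartDisc F₁| ≤ |quartDisc F₂| ∧ |quartDisc F₂| ≤ |quartDisc F₃| ∧
              R₁ ^ 2 * |(quartDisc F₃ : ℝ)| ≤ |(quartDisc F₁ : ℝ)| ∧
              |(quartDisc F₂ : ℝ)| < R₂ ^ 2 * |(quartDisc F₃ : ℝ)|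

theorem abs_star4 (n : ℕ) : |((star4 n : ℤ) : ℝ)| = n := by
  rw [← Int.cast_abs, Int.abs_eq_natAbs, star4_natAbs]; simp

theorem Kof_pred {R₁ R₂ X t : ℝ} (h0 : 0 < R₁) (h12 : R₁ < R₂) (h21 : R₂ ≤ 1) (ht : 0 < t)
    (hX : (t ^ 3) ^ 2 = X) {v : Fin 3 → ℕ} (hv : v ∈ Sf (R₁ ^ 2) (R₂ ^ 2) t) (hg : Good v) :
    v 0 < v 1 ∧ v 1 ≤ v 2 ∧ Pred R₁ R₂ X (Kof v) := by
  rw [mem_Sf (by positivity) (by gcongr) (pow_le_one₀ (by linarith) h21) ht] at hv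
  obtain ⟨q1, q2, q3, q4⟩ := hv
  have hR2 : R₂ ^ 2 ≤ 1 := pow_le_one₀ (by linarith) h21
  have h1 : v 0 < v 1 := by
    have : (v 0 : ℝ) < v 1 := lt_of_lt_of_le q2 (mul_le_of_le_one_left (by positivity) hR2)
    exact_mod_cast this
  have h2 : v 1 ≤ v 2 := by exact_mod_cast q1
  refine ⟨h1, h2, ?_⟩
  obtain ⟨l1, l2, p0, fa, fb, fc, lc⟩ := good_facts hg h1 h2
  have hab : star4 (v 0 * v 1) ≠ star4 (v 0 * v 2) := fun h => by have := star4_inj h; omega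
  have hac : star4 (v 0 * v 1) ≠ star4 (v 1 * v 2) := fun h => by have := star4_inj h; omega
  have hbc : star4 (v 0 * v 2) ≠ star4 (v 1 * v 2) := fun h => by have := star4_inj h; omega
  have hV : IsV4Quartic (Kof v) := biquad_V4 fa fb hab
  have ho : Odd (quartDisc (Kof v)) := biquad_odd fa fb hab
  have hd := biquad_disc hV.1 ho fa fb fc hab hac hbc le_sup_left le_sup_right lc
  have da := quartDisc_Qd fa
  have db := quartDisc_Qd fb
  have dc := quartDisc_Qd fc
  obtain ⟨⟨o0, o1, o2⟩, -⟩ := (good_iff v).1 hg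
  have p1 : (0:ℝ) < v 1 := by exact_mod_cast (by omega : 0 < v 1)
  have p2 : (0:ℝ) < v 2 := by exact_mod_cast (by omega : 0 < v 2)
  refine ⟨hV, ?_, ho, Qd (star4 (v 0 * v 1)), Qd (star4 (v 0 * v 2)), Qd (star4 (v 1 * v 2)),
    fun h => hab (by rw [← da, h, db]), fun h => hac (by rw [← da, h, dc]),
    fun h => hbc (by rw [← db, h, dc]), ⟨le_sup_left, finrank_Qd fa⟩, ⟨le_sup_right, finrank_Qd fb⟩,
    ⟨lc, finrank_Qd fc⟩, ?_, ?_, ?_, ?_⟩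
  · have : quartDisc (Kof v) = ((v 2 * v 1 * v 0 : ℕ) : ℤ) ^ 2 := by
      have e := abs_star4 (v 1 * v 2)
      rw [hd, star4_mul o0 o1 o2, mul_assoc, ← sq, ← Int.natAbs_sq (star4 _), star4_natAbs]
      push_cast; ring
    rw [this, ← hX]
    push_cast
    gcongr
  · rw [da, db, Int.abs_eq_natAbs, Int.abs_eq_natAbs, star4_natAbs, star4_natAbs]
    exact_mod_cast l1.le
  · rw [dc, db, Int.abs_eq_natAbs, Int.abs_eq_natAbs, star4_natAbs, star4_natAbs]
    exact_mod_cast l2.le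
  · rw [da, dc, abs_star4, abs_star4]
    push_cast
    nlinarith
  · rw [db, dc, abs_star4, abs_star4]
    push_cast
    nlinarith

theorem Kof_surj {R₁ R₂ X t : ℝ} (h0 : 0 < R₁) (h12 : R₁ < R₂) (h21 : R₂ ≤ 1) (ht : 0 < t)
    (hX : (t ^ 3) ^ 2 = X) {K : IntermediateField ℚ ℂ} (hK : Pred R₁ R₂ X K) :
    ∃ v ∈ Sf (R₁ ^ 2) (R₂ ^ 2) t, Good v ∧ Kof v = K := by
  obtain ⟨hV, hlt, ho, F₁, F₂, F₃, n12, n13, n23, ⟨l1, f1⟩, ⟨l2, f2⟩, ⟨l3, f3⟩, a12, a23, r1, r2⟩ := hK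
  have odd_of : ∀ F : IntermediateField ℚ ℂ, F ≤ K → Module.finrank ℚ F = 2 → Odd (quartDisc F) := by
    intro F hF hf
    obtain ⟨m, hm⟩ := quad_disc_dvd hV.1 hf hF
    rw [hm, Int.odd_mul, sq, Int.odd_mul] at ho
    exact ho.1.1
  obtain ⟨fa, e1⟩ := quad_eq_Qd f1 (odd_of F₁ l1 f1)
  obtain ⟨fb, e2⟩ := quad_eq_Qd f2 (odd_of F₂ l2 f2)
  obtain ⟨fc, e3⟩ := quad_eq_Qd f3 (odd_of F₃ l3 f3)
  set a := quartDisc F₁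
  set b := quartDisc F₂
  set c := quartDisc F₃
  have hab : a ≠ b := fun h => n12 (by rw [e1, e2, h])
  have hac : a ≠ c := fun h => n13 (by rw [e1, e3, h])
  have hbc : b ≠ c := fun h => n23 (by rw [e2, e3, h])
  rw [e1] at l1
  rw [e2] at l2
  rw [e3] at l3
  obtain ⟨k, hk⟩ := third hV.1 fa fb fc hab hac hbc l1 l2 l3
  have hd := biquad_disc hV.1 ho fa fb fc hab hac hbc l1 l2 l3
  obtain ⟨x, y, z, ea, eb, ec, cxy, cxz, cyz⟩ := three_sf (k := k.natAbs) fa.sf fb.sf fc.sf (by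
      rw [← Int.natAbs_mul, ← Int.natAbs_mul, hk, Int.natAbs_pow])
  have ea' := fa.eq_star4
  have eb' := fb.eq_star4
  have ec' := fc.eq_star4
  rw [ea] at ea'
  rw [eb] at eb'
  rw [ec] at ec'
  have sa := fa.sf
  have sb := fb.sf
  have sc := fc.sf
  have oa : Odd a.natAbs := by rw [Int.natAbs_odd, Int.odd_iff]; have := fa.2.1; omega
  have oc : Odd c.natAbs := by rw [Int.natAbs_odd, Int.odd_iff]; have := fc.2.1; omega
  rw [ea] at sa oa
  rw [eb] at sb
  rw [ec] at sc oc
  rw [Nat.odd_mul] at oa oc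
  have hgood : Good ![x, y, z] := by
    rw [good_iff]
    exact ⟨⟨oa.1, oa.2, oc.2⟩, ⟨sa.of_mul_left, sa.of_mul_right, sc.of_mul_right⟩, cxy, cxz, cyz⟩
  have px : (0:ℝ) < x := by exact_mod_cast oa.1.pos
  have py : (0:ℝ) < y := by exact_mod_cast oa.2.pos
  have pz : (0:ℝ) < z := by exact_mod_cast oc.2.pos
  refine ⟨![x, y, z], ?_, hgood, ?_⟩
  · rw [mem_Sf (by positivity) (by gcongr) (pow_le_one₀ (by linarith) h21) ht]
    have A : |(a : ℝ)| = x * y := by rw [ea', abs_star4]; push_cast; ring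
    have B : |(b : ℝ)| = x * z := by rw [eb', abs_star4]; push_cast; ring
    have C : |(c : ℝ)| = y * z := by rw [ec', abs_star4]; push_cast; ring
    have a12' : |(a : ℝ)| ≤ |(b : ℝ)| := by exact_mod_cast a12
    rw [A, B] at a12'
    rw [A, C] at r1
    rw [B, C] at r2
    simp only [Matrix.cons_val]
    refine ⟨le_of_mul_le_mul_left a12' px, ?_, ?_, ?_⟩
    · apply lt_of_mul_lt_mul_right _ pz.le
      linarith
    · apply le_of_mul_le_mul_right _ py
      linarith
    · have : quartDisc K = ((z * y * x : ℕ) : ℤ) ^ 2 := by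
        rw [hd, ea', eb', ec', star4_mul oa.1 oa.2 oc.2, mul_assoc, ← sq, ← Int.natAbs_sq (star4 _),
          star4_natAbs]
        push_cast; ring
      rw [this, ← hX] at hlt
      push_cast at hlt
      exact lt_of_pow_lt_pow_left₀ 2 (by positivity) hlt
  · have hle : Kof ![x, y, z] ≤ K := by
      apply sup_le
      · simpa [← ea'] using l1
      · simpa [← eb'] using l2
    have hf : FiniteDimensional ℚ K := (nf hV.1).to_finiteDimensional
    apply IntermediateField.eq_of_le_of_finrank_eq hle
    rw [hV.1]
    have : Kof ![x, y, z] = Qd a ⊔ Qd b := by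
      simp [Kof, ← ea', ← eb']
    rw [this]
    exact finrank_biquad fa fb hab

open Classical in
theorem card_eq {R₁ R₂ X t : ℝ} (h0 : 0 < R₁) (h12 : R₁ < R₂) (h21 : R₂ ≤ 1) (ht : 0 < t)
    (hX : (t ^ 3) ^ 2 = X) :
    Nat.card {K : IntermediateField ℚ ℂ // Pred R₁ R₂ X K} =
      ((Sf (R₁ ^ 2) (R₂ ^ 2) t).filter Good).card := by
  rw [← Finset.card_image_of_injOn (f := Kof) (s := (Sf (R₁ ^ 2) (R₂ ^ 2) t).filter Good)]
  · apply Nat.subtype_card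
    intro K
    rw [Finset.mem_image]
    constructor
    · rintro ⟨v, hv, rfl⟩
      rw [Finset.mem_filter] at hv
      exact (Kof_pred h0 h12 h21 ht hX hv.1 hv.2).2.2
    · intro hK
      obtain ⟨v, hv, hg, e⟩ := Kof_surj h0 h12 h21 ht hX hK
      exact ⟨v, Finset.mem_filter.2 ⟨hv, hg⟩, e⟩
  · intro v hv w hw e
    rw [Finset.mem_coe, Finset.mem_filter] at hv hw
    obtain ⟨a1, a2, -⟩ := Kof_pred h0 h12 h21 ht hX hv.1 hv.2
    obtain ⟨b1, b2, -⟩ := Kof_pred h0 h12 h21 ht hX hw.1 hw.2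
    exact Kof_inj hv.2 a1 a2 hw.2 b1 b2 e

open Filter Topology in
theorem main_tendsto {R₁ R₂ : ℝ} (h0 : 0 < R₁) (h12 : R₁ < R₂) (h21 : R₂ ≤ 1) :
    Tendsto (fun X : ℝ => (Nat.card {K : IntermediateField ℚ ℂ // Pred R₁ R₂ X K} : ℝ)
      / X ^ ((1 : ℝ) / 2)) atTop (𝓝 (1 / 12 *
            (∏' p : {p : ℕ // p.Prime ∧ Odd p},
              (1 - 6 / (p.1 : ℝ) ^ 2 + 8 / (p.1 : ℝ) ^ 3 - 3 / (p.1 : ℝ) ^ 4)) *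
            (Real.log R₂ - Real.log R₁) ^ 2)) := by
  classical
  have hα : 0 < R₁ ^ 2 := by positivity
  have hαβ : R₁ ^ 2 < R₂ ^ 2 := by gcongr
  have hc := count_good hα hαβ (pow_le_one₀ (by linarith) h21)
  rw [Om_volume hα hαβ, Real.log_pow, Real.log_pow] at hc
  have ht : Tendsto (fun X : ℝ => X ^ ((1 : ℝ) / 6)) atTop atTop :=
    tendsto_rpow_atTop (by norm_num)
  have hc' := hc.comp ht
  have : ∀ P : ℝ, 1 / 6 * (((2 : ℕ) : ℝ) * Real.log R₂ - ((2 : ℕ) : ℝ) * Real.log R₁) ^ 2 * (1 / 8 * P)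
      = 1 / 12 * P * (Real.log R₂ - Real.log R₁) ^ 2 := by
    intro P; push_cast; ring
  rw [this] at hc'
  refine hc'.congr' ?_
  filter_upwards [eventually_gt_atTop 0] with X hX
  have e3 : (X ^ ((1 : ℝ) / 6)) ^ 3 = X ^ ((1 : ℝ) / 2) := by
    rw [← Real.rpow_natCast, ← Real.rpow_mul hX.le]; norm_num
  have e6 : ((X ^ ((1 : ℝ) / 6)) ^ 3) ^ 2 = X := by
    rw [e3, ← Real.rpow_natCast, ← Real.rpow_mul hX.le]; norm_num
  have := card_eq h0 h12 h21 (Real.rpow_pos_of_pos hX _) e6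
  rw [Function.comp_apply, this, e3]
end

/-- For `0 < R₁ < R₂ ≤ 1`, the number of `V₄`-quartic subfields `K` of `ℂ`
with `Δ_K < X`, `Δ_K` odd, and with the discriminants `Δ₁, Δ₂, Δ₃` of the three quadratic
subfields (ordered by absolute value) satisfying `R₁²·|Δ₃| ≤ |Δ₁|` and `|Δ₂| < R₂²·|Δ₃|`,
equals `(1/12)·P·X^{1/2}·(log R₂ − log R₁)² + o(X^{1/2})`, where
`P = ∏_{p odd prime} (1 − 6p⁻² + 8p⁻³ − 3p⁻⁴)`. -/
theorem stmt5 (R₁ R₂ : ℝ) (h0 : 0 < R₁) (h12 : R₁ < R₂) (h21 : R₂ ≤ 1) :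
    (fun X : ℝ =>
        (Nat.card {K : IntermediateField ℚ ℂ //
            IsV4Quartic K ∧ (quartDisc K : ℝ) < X ∧ Odd (quartDisc K) ∧
            ∃ F₁ F₂ F₃ : IntermediateField ℚ ℂ,
              F₁ ≠ F₂ ∧ F₁ ≠ F₃ ∧ F₂ ≠ F₃ ∧
              IsQuadSubfield K F₁ ∧ IsQuadSubfield K F₂ ∧ IsQuadSubfield K F₃ ∧
              |quartDisc F₁| ≤ |quartDisc F₂| ∧ |quartDisc F₂| ≤ |quartDisc F₃| ∧
              R₁ ^ 2 * |(quartDisc F₃ : ℝ)| ≤ |(quartDisc F₁ : ℝ)| ∧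
              |(quartDisc F₂ : ℝ)| < R₂ ^ 2 * |(quartDisc F₃ : ℝ)|} : ℝ) -
          1 / 12 *
            (∏' p : {p : ℕ // p.Prime ∧ Odd p},
              (1 - 6 / (p.1 : ℝ) ^ 2 + 8 / (p.1 : ℝ) ^ 3 - 3 / (p.1 : ℝ) ^ 4)) *
            X ^ ((1 : ℝ) / 2) * (Real.log R₂ - Real.log R₁) ^ 2)
      =o[Filter.atTop] fun X : ℝ => X ^ ((1 : ℝ) / 2) := by
  have h := main_tendsto h0 h12 h21
  rw [Asymptotics.isLittleO_iff_tendsto']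
  · have h2 := h.sub_const (1 / 12 *
            (∏' p : {p : ℕ // p.Prime ∧ Odd p},
              (1 - 6 / (p.1 : ℝ) ^ 2 + 8 / (p.1 : ℝ) ^ 3 - 3 / (p.1 : ℝ) ^ 4)) *
            (Real.log R₂ - Real.log R₁) ^ 2)
    rw [sub_self] at h2
    refine h2.congr' ?_
    filter_upwards [Filter.eventually_gt_atTop 0] with X hX
    have hp : X ^ ((1 : ℝ) / 2) ≠ 0 := (Real.rpow_pos_of_pos hX _).ne'
    rw [sub_div]
    refine congrArg₂ (· - ·) rfl ?_
    field_simp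
  · filter_upwards [Filter.eventually_gt_atTop 0] with X hX h3
    exact absurd h3 (Real.rpow_pos_of_pos hX _).ne'
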